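/- arXiv:1708.01832 — 4 statements merged into one kernel-verified Lean document; each statement's English description precedes it below -/
import Mathlib

section
/- Let q = (q_k)_{k≥1} be a sequence of nonnegative reals with ∑_{k≥1} k·q_k < ∞, ∑_{k≥1} k·q_k > 2·∑_{k≥1} q_k, and q_1 > 0. Then there exists a unique β ∈ (0,1) such that ∑_{k≥1} k·q_k = (1 − β²)·∑_{k≥1} k·q_k/(1 − β^k). -/
/-- The ratio `(x - x ^ (k - 1)) / (1 - x ^ k)`, with the factor `1 - x` cancelled. It vanishes
for `k ≤ 2`. -/
noncomputable def geomRatio (k : ℕ) (x : ℝ) : ℝ :=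
  x * (∑ i ∈ Finset.range (k - 2), x ^ i) / ∑ i ∈ Finset.range k, x ^ i

lemma geom_sum_add_two (m : ℕ) (x : ℝ) :
    ∑ i ∈ Finset.range (m + 2), x ^ i
      = 1 + x * (∑ i ∈ Finset.range m, x ^ i) + x ^ (m + 1) := by
  rw [Finset.sum_range_succ, geom_sum_succ]
  ring

lemma add_mul_one_add_lt {a b c d : ℝ} (ha : 0 ≤ a) (hac : a < c) (hc : c < 1)
    (hb : 0 ≤ b) (hbd : b < d) (hd : d < 1) :
    (a + b) * (1 + c * d) < (c + d) * (1 + a * b) := by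
  have h₁ : 0 < (c - a) * (1 - b * d) := mul_pos (by linarith) (by nlinarith)
  have h₂ : 0 < (d - b) * (1 - a * c) := mul_pos (by linarith) (by nlinarith)
  nlinarith

lemma mul_geom_sum_mul_lt {m : ℕ} (hm : m ≠ 0) {x y : ℝ} (hx : 0 ≤ x) (hxy : x < y)
    (hy : y < 1) :
    x * (∑ i ∈ Finset.range m, x ^ i) * (1 + y ^ (m + 1))
      < y * (∑ i ∈ Finset.range m, y ^ i) * (1 + x ^ (m + 1)) := by
  have symmetrize (z : ℝ) : 2 * (z * ∑ i ∈ Finset.range m, z ^ i)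
      = ∑ i ∈ Finset.range m, (z ^ (i + 1) + z ^ (m - 1 - i + 1)) := by
    rw [Finset.sum_add_distrib, Finset.sum_range_reflect (fun i => z ^ (i + 1)) m,
      Finset.mul_sum, ← two_mul]
    simp only [pow_succ']
  have key : (∑ i ∈ Finset.range m, (x ^ (i + 1) + x ^ (m - 1 - i + 1))) * (1 + y ^ (m + 1))
      < (∑ i ∈ Finset.range m, (y ^ (i + 1) + y ^ (m - 1 - i + 1))) * (1 + x ^ (m + 1)) := by
    rw [Finset.sum_mul, Finset.sum_mul]
    refine Finset.sum_lt_sum_of_nonempty (Finset.nonempty_range_iff.2 hm) fun i hi => ?_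
    have hi' := Finset.mem_range.1 hi
    have hsplit (z : ℝ) : z ^ (m + 1) = z ^ (i + 1) * z ^ (m - 1 - i + 1) := by
      rw [← pow_add]
      congr 1
      omega
    rw [hsplit x, hsplit y]
    have hy0 : 0 ≤ y := hx.trans hxy.le
    exact add_mul_one_add_lt (by positivity) (pow_lt_pow_left₀ hxy hx (by omega))
      (pow_lt_one₀ hy0 hy (by omega)) (by positivity) (pow_lt_pow_left₀ hxy hx (by omega))
      (pow_lt_one₀ hy0 hy (by omega))
  rw [← symmetrize, ← symmetrize] at key
  linarith

lemma geomRatio_of_le_two {k : ℕ} (hk : k ≤ 2) (x : ℝ) : geomRatio k x = 0 := by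
  simp [geomRatio, Nat.sub_eq_zero_of_le hk]

lemma geomRatio_lt {k : ℕ} (hk : 3 ≤ k) {x y : ℝ} (hx : 0 ≤ x) (hxy : x < y) (hy : y < 1) :
    geomRatio k x < geomRatio k y := by
  obtain ⟨m, rfl⟩ := Nat.exists_eq_add_of_le' (show 2 ≤ k by omega)
  have key := mul_geom_sum_mul_lt (m := m) (by omega) hx hxy hy
  rw [geomRatio, geomRatio, div_lt_div_iff₀ (geom_sum_pos hx (by omega))
    (geom_sum_pos (hx.trans hxy.le) (by omega)), geom_sum_add_two, geom_sum_add_two,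
    Nat.add_sub_cancel]
  linarith

lemma geomRatio_mono {k : ℕ} {x y : ℝ} (hx : 0 ≤ x) (hxy : x < y) (hy : y < 1) :
    geomRatio k x ≤ geomRatio k y := by
  rcases le_or_gt k 2 with hk | hk
  · simp [geomRatio_of_le_two hk]
  · exact (geomRatio_lt hk hx hxy hy).le

lemma geomRatio_nonneg (k : ℕ) {x : ℝ} (hx : 0 ≤ x) : 0 ≤ geomRatio k x := by
  unfold geomRatio
  positivity

lemma geomRatio_le_one (k : ℕ) {x : ℝ} (hx : 0 ≤ x) : geomRatio k x ≤ 1 := by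
  rcases le_or_gt k 2 with hk | hk
  · simp [geomRatio_of_le_two hk]
  · obtain ⟨m, rfl⟩ := Nat.exists_eq_add_of_le' hk.le
    rw [geomRatio, div_le_one (geom_sum_pos hx (by omega)), geom_sum_add_two,
      Nat.add_sub_cancel]
    have : 0 ≤ x ^ (m + 1) := by positivity
    linarith

lemma continuousOn_geomRatio (k : ℕ) : ContinuousOn (geomRatio k) (Set.Ici 0) := by
  rcases le_or_gt k 2 with hk | hk
  · exact continuousOn_const.congr fun x _ => geomRatio_of_le_two hk x
  · refine ContinuousOn.div (by fun_prop) (by fun_prop) fun x hx => ?_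
    exact (geom_sum_pos hx (by omega)).ne'

lemma one_sub_sq_div_one_sub_pow (m : ℕ) {x : ℝ} (hx₀ : 0 ≤ x) (hx₁ : x < 1) :
    (1 - x ^ 2) / (1 - x ^ (m + 2)) = 1 - x * geomRatio (m + 2) x := by
  have hpos := geom_sum_pos hx₀ (show m + 2 ≠ 0 by omega)
  have hpow : 1 - x ^ (m + 2) ≠ 0 := (sub_pos.2 (pow_lt_one₀ hx₀ hx₁ (by omega))).ne'
  have hm := mul_neg_geom_sum x m
  have hm2 := mul_neg_geom_sum x (m + 2)
  have hx : 1 - x ≠ 0 := by linarith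
  rw [geomRatio, Nat.add_sub_cancel, div_eq_iff hpow, ← hm2]
  field_simp
  linear_combination x ^ 2 * hm - hm2

section

variable {q : ℕ → ℝ}

lemma summable_mul_geomRatio (hqnn : ∀ k, 0 ≤ q k) (hsum : Summable fun k : ℕ => (k : ℝ) * q k)
    {x : ℝ} (hx : 0 ≤ x) : Summable fun k : ℕ => (k : ℝ) * q k * geomRatio k x :=
  hsum.of_nonneg_of_le
    (fun k => mul_nonneg (mul_nonneg k.cast_nonneg (hqnn k)) (geomRatio_nonneg k hx))
    fun k => mul_le_of_le_one_right (mul_nonneg k.cast_nonneg (hqnn k)) (geomRatio_le_one k hx)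

lemma summable_of_summable_natCast_mul (hqnn : ∀ k, 0 ≤ q k)
    (hsum : Summable fun k : ℕ => (k : ℝ) * q k) : Summable q := by
  refine (summable_nat_add_iff 1).1 (((summable_nat_add_iff 1).2 hsum).of_nonneg_of_le
    (fun k => hqnn _) fun k => ?_)
  refine le_mul_of_one_le_left (hqnn _) ?_
  exact_mod_cast Nat.le_add_left 1 k

lemma continuousOn_tsum_mul_geomRatio (hqnn : ∀ k, 0 ≤ q k)
    (hsum : Summable fun k : ℕ => (k : ℝ) * q k) :
    ContinuousOn (fun x => ∑' k : ℕ, (k : ℝ) * q k * geomRatio k x) (Set.Ici 0) := by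
  refine continuousOn_tsum (fun k => continuousOn_const.mul (continuousOn_geomRatio k)) hsum
    fun k x hx => ?_
  have hk : 0 ≤ (k : ℝ) * q k := mul_nonneg k.cast_nonneg (hqnn k)
  rw [Real.norm_of_nonneg (mul_nonneg hk (geomRatio_nonneg k hx))]
  exact mul_le_of_le_one_right hk (geomRatio_le_one k hx)

lemma strictMonoOn_tsum_mul_geomRatio (hqnn : ∀ k, 0 ≤ q k)
    (hsum : Summable fun k : ℕ => (k : ℝ) * q k) {n : ℕ} (hn : 3 ≤ n) (hqn : 0 < q n) :
    StrictMonoOn (fun x => ∑' k : ℕ, (k : ℝ) * q k * geomRatio k x) (Set.Ico 0 1) := by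
  intro x hx y hy hxy
  refine Summable.tsum_lt_tsum (i := n) (fun k => ?_) ?_
    (summable_mul_geomRatio hqnn hsum hx.1) (summable_mul_geomRatio hqnn hsum hy.1)
  · exact mul_le_mul_of_nonneg_left (geomRatio_mono hx.1 hxy hy.2)
      (mul_nonneg k.cast_nonneg (hqnn k))
  · have hn₀ : (0 : ℝ) < n := by exact_mod_cast (by omega : 0 < n)
    exact mul_lt_mul_of_pos_left (geomRatio_lt hn hx.1 hxy hy.2) (mul_pos hn₀ hqn)

lemma tsum_mul_geomRatio_one (hq0 : q 0 = 0) (hqnn : ∀ k, 0 ≤ q k)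
    (hsum : Summable fun k : ℕ => (k : ℝ) * q k) :
    ∑' k : ℕ, (k : ℝ) * q k * geomRatio k 1
      = ∑' k : ℕ, (k : ℝ) * q k - 2 * ∑' k : ℕ, q k + q 1 := by
  have h := (hsum.hasSum.sub
    ((summable_of_summable_natCast_mul hqnn hsum).hasSum.mul_left 2)).add (hasSum_ite_eq 1 (q 1))
  rw [← h.tsum_eq]
  refine tsum_congr fun k => ?_
  match k with
  | 0 => simp [hq0]
  | 1 => simp [geomRatio]; ring
  | m + 2 =>
    have : (m : ℝ) + 2 ≠ 0 := by positivity
    simp [geomRatio]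
    field_simp
    ring

lemma one_sub_sq_mul_tsum (hqnn : ∀ k, 0 ≤ q k)
    (hsum : Summable fun k : ℕ => (k : ℝ) * q k) {x : ℝ} (hx₀ : 0 ≤ x) (hx₁ : x < 1) :
    (1 - x ^ 2) * ∑' k : ℕ, (k : ℝ) * q k / (1 - x ^ k)
      = ∑' k : ℕ, (k : ℝ) * q k
        + x * (q 1 - ∑' k : ℕ, (k : ℝ) * q k * geomRatio k x) := by
  have h := hsum.hasSum.add (((hasSum_ite_eq 1 (q 1)).sub
    (summable_mul_geomRatio hqnn hsum hx₀).hasSum).mul_left x)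
  rw [← h.tsum_eq, ← tsum_mul_left]
  refine tsum_congr fun k => ?_
  match k with
  | 0 => simp
  | 1 =>
    have : 1 - x ≠ 0 := by linarith
    simp [geomRatio]
    field_simp
    ring
  | m + 2 =>
    rw [mul_div_left_comm, one_sub_sq_div_one_sub_pow m hx₀ hx₁, if_neg (by omega)]
    ring

end

/-- Existence and uniqueness of `β = β(q)` solving
`∑_{k≥1} k q_k = (1 - β²) ∑_{k≥1} k q_k / (1 - β^k)`.
The sequence `q` is indexed by `ℕ` with `q 0 = 0`, so that sums over `k : ℕ`
coincide with sums over `k ≥ 1`. -/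
theorem exists_unique_beta (q : ℕ → ℝ) (hq0 : q 0 = 0) (hqnn : ∀ k, 0 ≤ q k)
    (hsum : Summable fun k : ℕ => (k : ℝ) * q k)
    (hgap : 2 * ∑' k : ℕ, q k < ∑' k : ℕ, (k : ℝ) * q k)
    (hq1 : 0 < q 1) :
    ∃! β : ℝ, β ∈ Set.Ioo (0 : ℝ) 1 ∧
      ∑' k : ℕ, (k : ℝ) * q k = (1 - β ^ 2) * ∑' k : ℕ, (k : ℝ) * q k / (1 - β ^ k) := by
  have equation_iff {x : ℝ} (hx : x ∈ Set.Ioo (0 : ℝ) 1) :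
      ∑' k : ℕ, (k : ℝ) * q k = (1 - x ^ 2) * ∑' k : ℕ, (k : ℝ) * q k / (1 - x ^ k) ↔
        ∑' k : ℕ, (k : ℝ) * q k * geomRatio k x = q 1 := by
    rw [one_sub_sq_mul_tsum hqnn hsum hx.1.le hx.2, left_eq_add, mul_eq_zero,
      or_iff_right hx.1.ne', sub_eq_zero, eq_comm]
  obtain ⟨n, hn, hqn⟩ : ∃ n, 3 ≤ n ∧ 0 < q n := by
    by_contra! h
    refine hgap.not_ge ?_
    rw [← tsum_mul_left]
    refine hsum.tsum_le_tsum (fun k => ?_)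
      ((summable_of_summable_natCast_mul hqnn hsum).mul_left 2)
    rcases le_or_gt k 2 with hk | hk
    · exact mul_le_mul_of_nonneg_right (by exact_mod_cast hk) (hqnn k)
    · simp [le_antisymm (h k hk) (hqnn k)]
  have hzero : ∑' k : ℕ, (k : ℝ) * q k * geomRatio k 0 = 0 := by simp [geomRatio]
  have hone := tsum_mul_geomRatio_one hq0 hqnn hsum
  obtain ⟨β, hβ, hβq⟩ := intermediate_value_Ioo zero_le_one
    ((continuousOn_tsum_mul_geomRatio hqnn hsum).mono Set.Icc_subset_Ici_self)
    (show q 1 ∈ Set.Ioo _ _ from ⟨by simpa only [hzero] using hq1, by simp only [hone]; linarith⟩)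
  refine ⟨β, ⟨hβ, (equation_iff hβ).2 hβq⟩, fun γ ⟨hγ, hγq⟩ => ?_⟩
  exact (strictMonoOn_tsum_mul_geomRatio hqnn hsum hn hqn).injOn (Set.Ioo_subset_Ico_self hγ)
    (Set.Ioo_subset_Ico_self hβ) (((equation_iff hγ).1 hγq).trans hβq.symm)
end

section
/- Assume in addition ∑_{k≥1} k²·p_k < ∞, ∑_{k≥1} k(k−2)·p_k ≤ 0, and T ≥ μ/2. Let G_0(z) := ∑_{k≥1} p_k·z^k for z ∈ [0,1], let F_1(t) := G_0(1) − G_0(t) = 1 − G_0(t), which is a strictly decreasing continuous bijection from [0,1] onto [0,1], and let f_1(t) := F_1^{−1}(t) for 0 ≤ t ≤ 1 and f_1(t) := 0 for t > 1. Define ζ_0(t) := 0, ζ_k(t) := p_k·(f_1(t))^k for k ≥ 1, and ψ(t) := −2·∫_0^t r_0(ζ(s)) ds + ∑_{k≥1} (k−2)·(p_k − ζ_k(t)). Then (ζ, ψ) ∈ C_T and I_T(ζ, ψ) = 0. -/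
open MeasureTheory Filter Topology
open scoped ENNReal

noncomputable def ell (x : ℝ) : ℝ := x * Real.log x - x + 1

noncomputable def rtot (x : ℕ → ℝ) : ℝ := max (x 0) 0 + ∑' k : ℕ, (k : ℝ) * x k

noncomputable def rcoord (x : ℕ → ℝ) (k : ℕ) : ℝ :=
  if 0 < rtot x then (if k = 0 then max (x 0) 0 else (k : ℝ) * x k) / rtot x else 0

noncomputable def skorokhod (ψ : ℝ → ℝ) (t : ℝ) : ℝ :=
  ψ t - min (sInf (ψ '' Set.Icc 0 t)) 0

def AbsCont (f : ℝ → ℝ) (a b : ℝ) : Prop :=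
  ∀ ε > 0, ∃ δ > 0, ∀ n : ℕ, ∀ I : Fin n → ℝ × ℝ,
    (∀ i, (I i).1 ∈ Set.Icc a b ∧ (I i).2 ∈ Set.Icc a b ∧ (I i).1 ≤ (I i).2) →
    (∀ i j, i ≠ j → Disjoint (Set.Ioo (I i).1 (I i).2) (Set.Ioo (I j).1 (I j).2)) →
    (∑ i, ((I i).2 - (I i).1)) < δ →
    (∑ i, |f (I i).2 - f (I i).1|) < ε

def memCT (T : ℝ) (p : ℕ → ℝ) (ζ : ℕ → ℝ → ℝ) (ψ : ℝ → ℝ) : Prop :=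
  (∀ k, ContinuousOn (ζ k) (Set.Icc 0 T)) ∧
  ContinuousOn ψ (Set.Icc 0 T) ∧
  ψ 0 = 0 ∧ AbsCont ψ 0 T ∧
  (∀ t ∈ Set.Icc (0:ℝ) T, ζ 0 t = skorokhod ψ t) ∧
  (∀ k : ℕ, 1 ≤ k →
    ζ k 0 = p k ∧ (∀ t ∈ Set.Icc (0:ℝ) T, 0 ≤ ζ k t) ∧
    AntitoneOn (ζ k) (Set.Icc 0 T) ∧ AbsCont (ζ k) 0 T)

noncomputable def Bint (ζ : ℕ → ℝ → ℝ) (φ : ℕ → ℝ → ℝ → ℝ) (k : ℕ) (t : ℝ) : ℝ :=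
  ∫ q in (Set.Icc (0:ℝ) t) ×ˢ (Set.Icc (0:ℝ) 1),
    (if 0 ≤ q.2 ∧ q.2 < rcoord (fun j => ζ j q.1) k then φ k q.1 q.2 else 0)

def memST (T : ℝ) (p : ℕ → ℝ) (ζ : ℕ → ℝ → ℝ) (ψ : ℝ → ℝ) (φ : ℕ → ℝ → ℝ → ℝ) : Prop :=
  (∀ k, Measurable (fun q : ℝ × ℝ => φ k q.1 q.2)) ∧
  (∀ k s y, 0 ≤ φ k s y) ∧
  (∀ k, IntegrableOn
      (fun q : ℝ × ℝ => if 0 ≤ q.2 ∧ q.2 < rcoord (fun j => ζ j q.1) k then φ k q.1 q.2 else 0)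
      ((Set.Icc (0:ℝ) T) ×ˢ (Set.Icc (0:ℝ) 1))) ∧
  (∀ t ∈ Set.Icc (0:ℝ) T, ψ t = ∑' k : ℕ, ((k : ℝ) - 2) * Bint ζ φ k t) ∧
  (∀ t ∈ Set.Icc (0:ℝ) T, ∀ k : ℕ, 1 ≤ k → ζ k t = p k - Bint ζ φ k t)

noncomputable def costE (T : ℝ) (φ : ℕ → ℝ → ℝ → ℝ) : ℝ≥0∞ :=
  ∑' k : ℕ, ∫⁻ q in (Set.Icc (0:ℝ) T) ×ˢ (Set.Icc (0:ℝ) 1),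
    ENNReal.ofReal (ell (φ k q.1 q.2))

open Classical in
noncomputable def rateI (T : ℝ) (p : ℕ → ℝ) (ζ : ℕ → ℝ → ℝ) (ψ : ℝ → ℝ) : ℝ≥0∞ :=
  if memCT T p ζ ψ then ⨅ (φ : ℕ → ℝ → ℝ → ℝ) (_ : memST T p ζ ψ φ), costE T φ else ⊤

lemma absCont_of_lipschitz {f : ℝ → ℝ} {a b C : ℝ} (hC : 0 < C)
    (hf : ∀ s ∈ Set.Icc a b, ∀ t ∈ Set.Icc a b, s ≤ t → |f t - f s| ≤ C * (t - s)) :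
    AbsCont f a b := by
  intro ε hε
  refine ⟨ε / C, by positivity, fun n I hI _ hsum => ?_⟩
  calc ∑ i, |f (I i).2 - f (I i).1| ≤ ∑ i, C * ((I i).2 - (I i).1) :=
        Finset.sum_le_sum fun i _ => hf _ (hI i).1 _ (hI i).2.1 (hI i).2.2
    _ = C * ∑ i, ((I i).2 - (I i).1) := by rw [Finset.mul_sum]
    _ < C * (ε / C) := by gcongr
    _ = ε := by field_simp

lemma continuousOn_of_lipschitz {f : ℝ → ℝ} {S : Set ℝ} {C : ℝ} (hC : 0 ≤ C)
    (hf : ∀ s ∈ S, ∀ t ∈ S, s ≤ t → |f t - f s| ≤ C * (t - s)) :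
    ContinuousOn f S := by
  refine (LipschitzOnWith.of_dist_le_mul (K := C.toNNReal) fun x hx y hy => ?_).continuousOn
  rw [Real.coe_toNNReal C hC, Real.dist_eq, Real.dist_eq]
  rcases le_total x y with h | h
  · rw [abs_sub_comm, abs_sub_comm x, abs_of_nonneg (sub_nonneg.2 h)]
    exact hf x hx y hy h
  · rw [abs_of_nonneg (sub_nonneg.2 h)]
    exact hf y hy x hx h

lemma skorokhod_eq_zero_of_antitoneOn {ψ : ℝ → ℝ} {t : ℝ} (ht : 0 ≤ t)
    (hψ : AntitoneOn ψ (Set.Icc 0 t)) (h0 : ψ 0 = 0) : skorokhod ψ t = 0 := by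
  have hmem : t ∈ Set.Icc (0 : ℝ) t := ⟨ht, le_rfl⟩
  have hleast : IsLeast (ψ '' Set.Icc 0 t) (ψ t) :=
    ⟨⟨t, hmem, rfl⟩, by rintro _ ⟨s, hs, rfl⟩; exact hψ hs hmem hs.2⟩
  have hle : ψ t ≤ 0 := h0 ▸ hψ ⟨le_rfl, ht⟩ hmem ht
  rw [skorokhod, hleast.csInf_eq, min_eq_left hle, sub_self]

lemma pow_sub_pow_le_mul {a b : ℝ} (ha : 0 ≤ a) (hab : a ≤ b) (hb : b ≤ 1) (k : ℕ) :
    b ^ k - a ^ k ≤ k * (b - a) := by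
  induction k with
  | zero => simp
  | succ k ih =>
    have h1 : b * (b ^ k - a ^ k) ≤ b ^ k - a ^ k :=
      mul_le_of_le_one_left (sub_nonneg.2 (pow_le_pow_left₀ ha hab k)) hb
    have h2 : (b - a) * a ^ k ≤ b - a :=
      mul_le_of_le_one_right (sub_nonneg.2 hab) (pow_le_one₀ ha (hab.trans hb))
    push_cast
    calc b ^ (k + 1) - a ^ (k + 1) = b * (b ^ k - a ^ k) + (b - a) * a ^ k := by ring
      _ ≤ (k + 1) * (b - a) := by linarith

section GeneratingFunction

variable {p : ℕ → ℝ}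

lemma summable_natCast_mul (hpnn : ∀ k, 0 ≤ p k)
    (hmom2 : Summable fun k : ℕ => (k : ℝ) ^ 2 * p k) :
    Summable fun k : ℕ => (k : ℝ) * p k := by
  refine Summable.of_nonneg_of_le (fun k => mul_nonneg k.cast_nonneg (hpnn k)) (fun k => ?_) hmom2
  refine mul_le_mul_of_nonneg_right ?_ (hpnn k)
  exact_mod_cast Nat.le_self_pow two_ne_zero k

lemma summable_mul_pow {q : ℕ → ℝ} (hq : ∀ k, 0 ≤ q k) (hs : Summable q) {z : ℝ}
    (hz : z ∈ Set.Icc (0 : ℝ) 1) : Summable fun k => q k * z ^ k :=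
  Summable.of_nonneg_of_le (fun k => mul_nonneg (hq k) (pow_nonneg hz.1 k))
    (fun k => mul_le_of_le_one_right (hq k) (pow_le_one₀ hz.1 hz.2)) hs

lemma monotoneOn_tsum_mul_pow {q : ℕ → ℝ} (hq : ∀ k, 0 ≤ q k) (hs : Summable q) :
    MonotoneOn (fun z : ℝ => ∑' k, q k * z ^ k) (Set.Icc 0 1) := fun _ ha _ hb hab =>
  Summable.tsum_le_tsum (fun k => mul_le_mul_of_nonneg_left (pow_le_pow_left₀ ha.1 hab k) (hq k))
    (summable_mul_pow hq hs ha) (summable_mul_pow hq hs hb)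

lemma exists_pos_of_tsum_eq_one (hp0 : p 0 = 0) (hpnn : ∀ k, 0 ≤ p k) (hp1 : ∑' k, p k = 1) :
    ∃ k, k ≠ 0 ∧ 0 < p k := by
  by_contra! h
  have : p = 0 := funext fun k => by
    rcases eq_or_ne k 0 with rfl | hk
    · exact hp0
    · exact le_antisymm (h k hk) (hpnn k)
  simp [this] at hp1

lemma strictMonoOn_tsum_mul_pow (hp0 : p 0 = 0) (hpnn : ∀ k, 0 ≤ p k) (hs : Summable p)
    (hp1 : ∑' k, p k = 1) : StrictMonoOn (fun z : ℝ => ∑' k, p k * z ^ k) (Set.Icc 0 1) := by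
  intro a ha b hb hab
  obtain ⟨k, hk, hpk⟩ := exists_pos_of_tsum_eq_one hp0 hpnn hp1
  exact Summable.tsum_lt_tsum
    (fun j => mul_le_mul_of_nonneg_left (pow_le_pow_left₀ ha.1 hab.le j) (hpnn j))
    (mul_lt_mul_of_pos_left (pow_lt_pow_left₀ hab ha.1 hk) hpk)
    (summable_mul_pow hpnn hs ha) (summable_mul_pow hpnn hs hb)

lemma hasDerivAt_tsum_mul_pow (hpnn : ∀ k, 0 ≤ p k)
    (hs1 : Summable fun k : ℕ => (k : ℝ) * p k) {z : ℝ} (hz : z ∈ Set.Ioo (-1 : ℝ) 1) :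
    HasDerivAt (fun z : ℝ => ∑' k, p k * z ^ k) (∑' k : ℕ, p k * (k * z ^ (k - 1))) z := by
  refine hasDerivAt_tsum_of_isPreconnected (y₀ := 0) hs1 isOpen_Ioo isPreconnected_Ioo
    (fun k y _ => (hasDerivAt_pow k y).const_mul (p k)) (fun k y hy => ?_) (by simp) ?_ hz
  · rw [Real.norm_eq_abs, abs_mul, abs_mul, abs_pow, abs_of_nonneg (hpnn k), Nat.abs_cast,
      mul_comm (k : ℝ) (p k)]
    refine mul_le_mul_of_nonneg_left (mul_le_of_le_one_right k.cast_nonneg ?_) (hpnn k)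
    exact pow_le_one₀ (abs_nonneg y) (abs_lt.2 hy).le
  · refine summable_of_ne_finset_zero (s := {0}) fun k hk => ?_
    have : k ≠ 0 := by simpa using hk
    simp [this]

lemma tsum_size_biased_le (hpnn : ∀ k, 0 ≤ p k) (hs : Summable p)
    (hmom2 : Summable fun k : ℕ => (k : ℝ) ^ 2 * p k)
    (hsub : ∑' k : ℕ, (k : ℝ) * ((k : ℝ) - 2) * p k ≤ 0)
    {a b : ℝ} (ha : 0 ≤ a) (hab : a ≤ b) (hb : b ≤ 1) :
    ∑' k : ℕ, ((k : ℝ) - 2) * (p k * b ^ k - p k * a ^ k) ≤ 0 := by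
  have hs1 := summable_natCast_mul hpnn hmom2
  have hk1 := fun k => mul_nonneg (Nat.cast_nonneg (α := ℝ) k) (hpnn k)
  have ia : a ∈ Set.Icc (0 : ℝ) 1 := ⟨ha, hab.trans hb⟩
  have ib : b ∈ Set.Icc (0 : ℝ) 1 := ⟨ha.trans hab, hb⟩
  have hL : Summable fun k : ℕ => ((k : ℝ) - 2) * (p k * b ^ k - p k * a ^ k) := by
    refine (((summable_mul_pow hk1 hs1 ib).sub (summable_mul_pow hk1 hs1 ia)).sub
      (((summable_mul_pow hpnn hs ib).sub (summable_mul_pow hpnn hs ia)).mul_left 2)).congr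
      fun k => ?_
    ring
  have hR : Summable fun k : ℕ => (k : ℝ) * ((k : ℝ) - 2) * p k := by
    refine (hmom2.sub (hs1.mul_left 2)).congr fun k => ?_
    ring
  calc ∑' k : ℕ, ((k : ℝ) - 2) * (p k * b ^ k - p k * a ^ k)
      ≤ ∑' k : ℕ, (b - a) * ((k : ℝ) * ((k : ℝ) - 2) * p k) := by
        refine Summable.tsum_le_tsum (fun k => ?_) hL (hR.mul_left _)
        suffices h : ((k : ℝ) - 2) * (b ^ k - a ^ k) ≤ ((k : ℝ) - 2) * (k * (b - a)) by
          have := mul_le_mul_of_nonneg_left h (hpnn k)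
          linarith
        match k with
        | 0 => simp
        | 1 => simp
        | k + 2 =>
          refine mul_le_mul_of_nonneg_left (pow_sub_pow_le_mul ha hab hb _) ?_
          push_cast
          linarith [(Nat.cast_nonneg k : (0 : ℝ) ≤ k)]
    _ = (b - a) * ∑' k : ℕ, (k : ℝ) * ((k : ℝ) - 2) * p k := tsum_mul_left
    _ ≤ 0 := mul_nonpos_of_nonneg_of_nonpos (sub_nonneg.2 hab) hsub

lemma rcoord_mul_pow (hp0 : p 0 = 0) (z : ℝ) (k : ℕ) :
    rcoord (fun j => p j * z ^ j) k =
      if 0 < ∑' j : ℕ, (j : ℝ) * p j * z ^ j then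
        k * p k * z ^ k / ∑' j : ℕ, (j : ℝ) * p j * z ^ j else 0 := by
  have : rtot (fun j => p j * z ^ j) = ∑' j : ℕ, (j : ℝ) * p j * z ^ j := by
    simp [rtot, hp0, mul_assoc]
  rw [rcoord, this]
  rcases eq_or_ne k 0 with rfl | hk
  · simp [hp0]
  · simp [hk, mul_assoc]

lemma rcoord_mul_pow_mem_Icc (hp0 : p 0 = 0) (hpnn : ∀ k, 0 ≤ p k)
    (hs1 : Summable fun k : ℕ => (k : ℝ) * p k) {z : ℝ} (hz : z ∈ Set.Icc (0 : ℝ) 1) (k : ℕ) :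
    rcoord (fun j => p j * z ^ j) k ∈ Set.Icc (0 : ℝ) 1 := by
  have hk1 := fun k => mul_nonneg (Nat.cast_nonneg (α := ℝ) k) (hpnn k)
  have hnn : ∀ j : ℕ, 0 ≤ (j : ℝ) * p j * z ^ j := fun j => mul_nonneg (hk1 j) (pow_nonneg hz.1 j)
  rw [rcoord_mul_pow hp0]
  split_ifs with h
  · exact ⟨div_nonneg (hnn k) h.le, (div_le_one h).2
      ((summable_mul_pow hk1 hs1 hz).le_tsum k fun j _ => hnn j)⟩
  · simp

lemma rcoord_mul_pow_of_pos (hp0 : p 0 = 0) (hpnn : ∀ k, 0 ≤ p k) (hp1 : ∑' k, p k = 1)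
    (hs1 : Summable fun k : ℕ => (k : ℝ) * p k) {z : ℝ} (hz : z ∈ Set.Ioc (0 : ℝ) 1) (k : ℕ) :
    0 < ∑' j : ℕ, p j * (j * z ^ (j - 1)) ∧
      rcoord (fun j => p j * z ^ j) k =
        p k * (k * z ^ (k - 1)) / ∑' j : ℕ, p j * (j * z ^ (j - 1)) := by
  have hk1 := fun k => mul_nonneg (Nat.cast_nonneg (α := ℝ) k) (hpnn k)
  have hterm : ∀ j : ℕ, (j : ℝ) * p j * z ^ j = z * (p j * (j * z ^ (j - 1))) := by
    rintro (_ | j)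
    · simp
    · rw [Nat.add_sub_cancel, pow_succ]; ring
  have hsum : ∑' j : ℕ, (j : ℝ) * p j * z ^ j = z * ∑' j : ℕ, p j * (j * z ^ (j - 1)) := by
    rw [← tsum_mul_left]; exact tsum_congr hterm
  have hpos : 0 < ∑' j : ℕ, (j : ℝ) * p j * z ^ j := by
    obtain ⟨i, hi, hpi⟩ := exists_pos_of_tsum_eq_one hp0 hpnn hp1
    have hz0 := hz.1
    have hi' : (0 : ℝ) < i := by exact_mod_cast Nat.pos_of_ne_zero hi
    exact (summable_mul_pow hk1 hs1 ⟨hz.1.le, hz.2⟩).tsum_pos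
      (fun j => mul_nonneg (hk1 j) (pow_nonneg hz.1.le j)) i (by positivity)
  have hpos' : 0 < ∑' j : ℕ, p j * (j * z ^ (j - 1)) := by
    rw [hsum] at hpos
    exact pos_of_mul_pos_right hpos hz.1.le
  refine ⟨hpos', ?_⟩
  rw [rcoord_mul_pow hp0, if_pos hpos, hterm, hsum, mul_div_mul_left _ _ hz.1.ne']

lemma rcoord_mul_zero_pow (hp0 : p 0 = 0) (k : ℕ) : rcoord (fun j => p j * (0 : ℝ) ^ j) k = 0 := by
  have : ∀ j : ℕ, (j : ℝ) * p j * (0 : ℝ) ^ j = 0 := by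
    rintro (_ | j) <;> simp
  rw [rcoord_mul_pow hp0]
  simp [this]

end GeneratingFunction

section Inverse

variable {p : ℕ → ℝ} {f : ℝ → ℝ}

lemma antitoneOn_inverse (hp0 : p 0 = 0) (hpnn : ∀ k, 0 ≤ p k) (hs : Summable p)
    (hp1 : ∑' k, p k = 1) (hf : ∀ t, 0 ≤ t → f t ∈ Set.Icc (0 : ℝ) 1)
    (hG : ∀ t, 0 ≤ t → ∑' k, p k * f t ^ k = max (1 - t) 0) :
    AntitoneOn f (Set.Ici 0) := by
  intro s hs0 t ht0 hst
  refine ((strictMonoOn_tsum_mul_pow hp0 hpnn hs hp1).le_iff_le (hf t ht0) (hf s hs0)).1 ?_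
  simp only [hG t ht0, hG s hs0]
  exact max_le_max_right 0 (by linarith)

lemma max_one_sub_sub_le {s t : ℝ} (hst : s ≤ t) : max (1 - s) 0 - max (1 - t) 0 ≤ t - s := by
  rw [sub_le_iff_le_add]
  refine max_le ?_ (add_nonneg (sub_nonneg.2 hst) (le_max_right _ _))
  linarith [le_max_left (1 - t) 0]

lemma abs_mul_pow_inverse_sub_le (hpnn : ∀ k, 0 ≤ p k) (hs : Summable p)
    (hf : ∀ t, 0 ≤ t → f t ∈ Set.Icc (0 : ℝ) 1)
    (hG : ∀ t, 0 ≤ t → ∑' k, p k * f t ^ k = max (1 - t) 0)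
    (hanti : AntitoneOn f (Set.Ici 0)) (k : ℕ) {s t : ℝ} (hs0 : 0 ≤ s) (hst : s ≤ t) :
    |p k * f t ^ k - p k * f s ^ k| ≤ 1 * (t - s) := by
  have ht0 := hs0.trans hst
  have hnn : ∀ j, 0 ≤ p j * f s ^ j - p j * f t ^ j := fun j => sub_nonneg.2
    (mul_le_mul_of_nonneg_left (pow_le_pow_left₀ (hf t ht0).1 (hanti hs0 ht0 hst) j) (hpnn j))
  have h1 := summable_mul_pow hpnn hs (hf s hs0)
  have h2 := summable_mul_pow hpnn hs (hf t ht0)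
  rw [abs_sub_comm, abs_of_nonneg (hnn k), one_mul]
  calc p k * f s ^ k - p k * f t ^ k ≤ ∑' j, (p j * f s ^ j - p j * f t ^ j) :=
        (h1.sub h2).le_tsum k fun j _ => hnn j
    _ = max (1 - s) 0 - max (1 - t) 0 := by rw [h1.tsum_sub h2, hG s hs0, hG t ht0]
    _ ≤ t - s := max_one_sub_sub_le hst

lemma continuousOn_inverse (hp0 : p 0 = 0) (hpnn : ∀ k, 0 ≤ p k) (hs : Summable p)
    (hp1 : ∑' k, p k = 1) (hf : ∀ t, 0 ≤ t → f t ∈ Set.Icc (0 : ℝ) 1)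
    (hG : ∀ t, 0 ≤ t → ∑' k, p k * f t ^ k = max (1 - t) 0) :
    ContinuousOn f (Set.Ici 0) := by
  obtain ⟨k, hk, hpk⟩ := exists_pos_of_tsum_eq_one hp0 hpnn hp1
  have hanti := antitoneOn_inverse hp0 hpnn hs hp1 hf hG
  have h1 : ContinuousOn (fun t => p k * f t ^ k) (Set.Ici 0) :=
    continuousOn_of_lipschitz zero_le_one fun s hs0 t _ hst =>
      abs_mul_pow_inverse_sub_le hpnn hs hf hG hanti k hs0 hst
  have h2 : ContinuousOn (fun t => (p k * f t ^ k / p k) ^ ((k : ℝ)⁻¹)) (Set.Ici 0) :=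
    (h1.div_const _).rpow_const fun _ _ => Or.inr (by positivity)
  refine h2.congr fun t ht => ?_
  simp only [mul_div_cancel_left₀ _ hpk.ne']
  exact (Real.pow_rpow_inv_natCast (hf t ht).1 hk).symm

lemma inverse_eq_zero (hp0 : p 0 = 0) (hpnn : ∀ k, 0 ≤ p k) (hs : Summable p)
    (hp1 : ∑' k, p k = 1) (hf : ∀ t, 0 ≤ t → f t ∈ Set.Icc (0 : ℝ) 1)
    (hG : ∀ t, 0 ≤ t → ∑' k, p k * f t ^ k = max (1 - t) 0) {t : ℝ} (ht : 1 ≤ t) : f t = 0 := by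
  refine (strictMonoOn_tsum_mul_pow hp0 hpnn hs hp1).injOn (hf t (by linarith)) (by simp) ?_
  have : ∀ k, p k * (0 : ℝ) ^ k = 0 := by
    rintro (_ | k) <;> simp [hp0]
  simp only [hG t (by linarith), this, tsum_zero]
  exact max_eq_right (by linarith)

lemma inverse_mem_Ioo (hp0 : p 0 = 0) (hp1 : ∑' k, p k = 1)
    (hf : ∀ t, 0 ≤ t → f t ∈ Set.Icc (0 : ℝ) 1)
    (hG : ∀ t, 0 ≤ t → ∑' k, p k * f t ^ k = max (1 - t) 0) {t : ℝ}
    (ht : t ∈ Set.Ioo (0 : ℝ) 1) : f t ∈ Set.Ioo (0 : ℝ) 1 := by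
  have hGt := hG t ht.1.le
  rw [max_eq_left (by linarith [ht.2])] at hGt
  refine ⟨lt_of_le_of_ne (hf t ht.1.le).1 fun h => ?_,
    lt_of_le_of_ne (hf t ht.1.le).2 fun h => ?_⟩
  · have : ∀ k, p k * (0 : ℝ) ^ k = 0 := by
      rintro (_ | k) <;> simp [hp0]
    simp only [← h, this, tsum_zero] at hGt
    linarith [ht.2]
  · simp only [h, one_pow, mul_one, hp1] at hGt
    linarith [ht.1]

lemma hasDerivAt_mul_pow_inverse (hp0 : p 0 = 0) (hpnn : ∀ k, 0 ≤ p k) (hs : Summable p)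
    (hp1 : ∑' k, p k = 1) (hs1 : Summable fun k : ℕ => (k : ℝ) * p k)
    (hf : ∀ t, 0 ≤ t → f t ∈ Set.Icc (0 : ℝ) 1)
    (hG : ∀ t, 0 ≤ t → ∑' k, p k * f t ^ k = max (1 - t) 0) (k : ℕ) {t : ℝ} (ht0 : 0 < t)
    (ht1 : t ≠ 1) :
    HasDerivAt (fun t => p k * f t ^ k) (-rcoord (fun j => p j * f t ^ j) k) t := by
  rcases lt_or_gt_of_ne ht1 with h | h
  · have hft := inverse_mem_Ioo hp0 hp1 hf hG ⟨ht0, h⟩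
    obtain ⟨hpos, hr⟩ := rcoord_mul_pow_of_pos hp0 hpnn hp1 hs1 ⟨hft.1, hft.2.le⟩ k
    have hGd := (hasDerivAt_tsum_mul_pow hpnn hs1 (z := f t)
      ⟨by linarith [hft.1], hft.2⟩).const_sub 1
    have hcont : ContinuousAt f t :=
      (continuousOn_inverse hp0 hpnn hs hp1 hf hG).continuousAt (Ici_mem_nhds ht0)
    have hfd := HasDerivAt.of_local_left_inverse hcont hGd (neg_ne_zero.2 hpos.ne') (by
      filter_upwards [Ioo_mem_nhds ht0 h] with s hs'
      rw [hG s hs'.1.le, max_eq_left (by linarith [hs'.2])]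
      ring)
    refine ((hfd.pow k).const_mul (p k)).congr_deriv ?_
    rw [hr, inv_neg]
    ring
  · rw [inverse_eq_zero hp0 hpnn hs hp1 hf hG h.le, rcoord_mul_zero_pow hp0, neg_zero]
    refine (hasDerivAt_const t (p k * (0 : ℝ) ^ k)).congr_of_eventuallyEq ?_
    filter_upwards [Ioi_mem_nhds h] with s hs'
    rw [inverse_eq_zero hp0 hpnn hs hp1 hf hG (le_of_lt hs')]

lemma measurable_rcoord_inverse (hp0 : p 0 = 0) (hpnn : ∀ k, 0 ≤ p k)
    (hs1 : Summable fun k : ℕ => (k : ℝ) * p k)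
    (hf : ∀ t, 0 ≤ t → f t ∈ Set.Icc (0 : ℝ) 1) (hanti : AntitoneOn f (Set.Ici 0)) (k : ℕ) :
    Measurable fun s => rcoord (fun j => p j * f (max s 0) ^ j) k := by
  have hk1 := fun k => mul_nonneg (Nat.cast_nonneg (α := ℝ) k) (hpnn k)
  have hF : Antitone fun s => f (max s 0) := fun s t hst =>
    hanti (le_max_right s 0) (le_max_right t 0) (max_le_max_right 0 hst)
  have hH : Antitone fun s => ∑' j : ℕ, (j : ℝ) * p j * f (max s 0) ^ j := fun s t hst =>
    monotoneOn_tsum_mul_pow hk1 hs1 (hf _ (le_max_right _ _)) (hf _ (le_max_right _ _)) (hF hst)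
  simp only [rcoord_mul_pow hp0]
  exact Measurable.ite (measurableSet_lt measurable_const hH.measurable)
    (((hF.measurable.pow_const k).const_mul _).div hH.measurable) measurable_const

lemma integral_rcoord_inverse (hp0 : p 0 = 0) (hpnn : ∀ k, 0 ≤ p k) (hs : Summable p)
    (hp1 : ∑' k, p k = 1) (hs1 : Summable fun k : ℕ => (k : ℝ) * p k)
    (hf : ∀ t, 0 ≤ t → f t ∈ Set.Icc (0 : ℝ) 1)
    (hG : ∀ t, 0 ≤ t → ∑' k, p k * f t ^ k = max (1 - t) 0) (hf0 : f 0 = 1) (k : ℕ) {t : ℝ}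
    (ht : 0 ≤ t) :
    ∫ s in Set.Icc 0 t, rcoord (fun j => p j * f (max s 0) ^ j) k = p k - p k * f t ^ k := by
  have hanti := antitoneOn_inverse hp0 hpnn hs hp1 hf hG
  have hmeas := measurable_rcoord_inverse hp0 hpnn hs1 hf hanti k
  have hint : IntervalIntegrable (fun s => rcoord (fun j => p j * f (max s 0) ^ j) k)
      volume 0 t := by
    refine (intervalIntegrable_const (c := (1 : ℝ))).mono_fun hmeas.aestronglyMeasurable
      (Eventually.of_forall fun s => ?_)
    have := rcoord_mul_pow_mem_Icc hp0 hpnn hs1 (hf _ (le_max_right s 0)) k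
    simpa [abs_of_nonneg this.1] using this.2
  have hcont : ContinuousOn (fun t => p k * f t ^ k) (Set.Icc 0 t) :=
    continuousOn_const.mul (((continuousOn_inverse hp0 hpnn hs hp1 hf hG).mono
      Set.Icc_subset_Ici_self).pow k)
  have := integral_eq_of_hasDerivAt_off_countable_of_le (fun t => p k * f t ^ k)
    (fun s => -rcoord (fun j => p j * f (max s 0) ^ j) k) ht (Set.countable_singleton (1 : ℝ))
    hcont (fun s hs' => by
      simpa [max_eq_left hs'.1.1.le] using
        hasDerivAt_mul_pow_inverse hp0 hpnn hs hp1 hs1 hf hG k hs'.1.1 hs'.2) hint.neg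
  rw [intervalIntegral.integral_neg] at this
  rw [integral_Icc_eq_integral_Ioc, ← intervalIntegral.integral_of_le ht]
  simp only [hf0, one_pow, mul_one] at this
  linarith

end Inverse

section Strip

lemma integrableOn_strip_indicator {r : ℝ → ℝ} (hr : Measurable r) (t : ℝ) :
    IntegrableOn (fun q : ℝ × ℝ => if 0 ≤ q.2 ∧ q.2 < r q.1 then (1 : ℝ) else 0)
      (Set.Icc (0 : ℝ) t ×ˢ Set.Icc (0 : ℝ) 1) := by
  have hset : MeasurableSet {q : ℝ × ℝ | 0 ≤ q.2 ∧ q.2 < r q.1} :=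
    (measurableSet_le measurable_const measurable_snd).inter
      (measurableSet_lt measurable_snd (hr.comp measurable_fst))
  have hfin : volume (Set.Icc (0 : ℝ) t ×ˢ Set.Icc (0 : ℝ) 1) ≠ ⊤ :=
    (isCompact_Icc.prod isCompact_Icc).measure_lt_top.ne
  refine (integrableOn_const (C := (1 : ℝ)) hfin).mono'
    (Measurable.ite hset measurable_const measurable_const).aestronglyMeasurable
    (Eventually.of_forall fun q => ?_)
  split_ifs <;> simp

lemma integral_strip_indicator {r : ℝ → ℝ} (hr : Measurable r)
    (hr1 : ∀ s, r s ∈ Set.Icc (0 : ℝ) 1) (t : ℝ) :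
    ∫ q in Set.Icc (0 : ℝ) t ×ˢ Set.Icc (0 : ℝ) 1,
      (if 0 ≤ q.2 ∧ q.2 < r q.1 then (1 : ℝ) else 0) = ∫ s in Set.Icc 0 t, r s := by
  have h := integrableOn_strip_indicator hr t
  rw [Measure.volume_eq_prod] at h ⊢
  rw [setIntegral_prod _ h]
  refine integral_congr_ae (Eventually.of_forall fun s => ?_)
  have : (fun y : ℝ => if 0 ≤ y ∧ y < r s then (1 : ℝ) else 0) =
      (Set.Ico 0 (r s)).indicator fun _ => 1 := by
    ext y
    simp [Set.indicator_apply]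
  dsimp only
  rw [this, setIntegral_indicator measurableSet_Ico, Set.inter_eq_right.2
    (Set.Ico_subset_Icc_self.trans (Set.Icc_subset_Icc_right (hr1 s).2))]
  simp [(hr1 s).1]

end Strip

/-- Law of large numbers, subcritical/critical case `∑ k(k-2)p_k ≤ 0`:
the explicit pair `(ζ, ψ)` built from the inverse `f₁` of `F₁(t) = 1 - G₀(t)`
belongs to `C_T` and has zero rate. The distribution `p` is indexed by `ℕ`
with `p 0 = 0`, so that sums over `k : ℕ` are sums over `k ≥ 1`. -/
theorem lln_subcritical (T : ℝ)
    (p : ℕ → ℝ) (hp0 : p 0 = 0) (hpnn : ∀ k, 0 ≤ p k) (hp1 : ∑' k : ℕ, p k = 1)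
    (hmom2 : Summable fun k : ℕ => (k : ℝ) ^ 2 * p k)
    (hsub : ∑' k : ℕ, (k : ℝ) * ((k : ℝ) - 2) * p k ≤ 0)
    (hT : (∑' k : ℕ, (k : ℝ) * p k) / 2 ≤ T)
    (f1 : ℝ → ℝ)
    (hf1inv : ∀ t ∈ Set.Icc (0 : ℝ) 1,
      f1 t ∈ Set.Icc (0 : ℝ) 1 ∧ 1 - ∑' k : ℕ, p k * (f1 t) ^ k = t)
    (hf1zero : ∀ t : ℝ, 1 < t → f1 t = 0)
    (ζ : ℕ → ℝ → ℝ) (ψ : ℝ → ℝ)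
    (hζ0 : ∀ t, ζ 0 t = 0)
    (hζk : ∀ k : ℕ, 1 ≤ k → ∀ t, ζ k t = p k * (f1 t) ^ k)
    (hψ : ∀ t, ψ t =
      -2 * (∫ s in (0 : ℝ)..t, rcoord (fun j => ζ j s) 0)
        + ∑' k : ℕ, (((k : ℝ) + 1) - 2) * (p (k + 1) - ζ (k + 1) t)) :
    memCT T p ζ ψ ∧ rateI T p ζ ψ = 0 := by
  have hs : Summable p := by
    by_contra h
    simp [tsum_eq_zero_of_not_summable h] at hp1
  have hs1 := summable_natCast_mul hpnn hmom2
  have hk1 := fun k => mul_nonneg (Nat.cast_nonneg (α := ℝ) k) (hpnn k)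
  have hzero : ∀ k, p k * (0 : ℝ) ^ k = 0 := by
    rintro (_ | k) <;> simp [hp0]
  have hf : ∀ t, 0 ≤ t → f1 t ∈ Set.Icc (0 : ℝ) 1 := fun t ht => by
    rcases le_or_gt t 1 with h | h
    · exact (hf1inv t ⟨ht, h⟩).1
    · simp [hf1zero t h]
  have hG : ∀ t, 0 ≤ t → ∑' k, p k * f1 t ^ k = max (1 - t) 0 := fun t ht => by
    rcases le_or_gt t 1 with h | h
    · rw [max_eq_left (by linarith)]
      linarith [(hf1inv t ⟨ht, h⟩).2]
    · rw [max_eq_right (by linarith)]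
      simp [hf1zero t h, hzero]
  have hf0 : f1 0 = 1 := by
    refine (strictMonoOn_tsum_mul_pow hp0 hpnn hs hp1).injOn (hf 0 le_rfl) (by simp) ?_
    simp [hG 0 le_rfl, hp1]
  have hanti := antitoneOn_inverse hp0 hpnn hs hp1 hf hG
  have hζ : ∀ k t, ζ k t = p k * f1 t ^ k := fun k t => by
    rcases Nat.eq_zero_or_pos k with rfl | hk
    · simp [hζ0, hp0]
    · exact hζk k hk t
  have hsummable : ∀ t, 0 ≤ t →
      Summable fun k : ℕ => ((k : ℝ) - 2) * (p k - p k * f1 t ^ k) := fun t ht => by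
    refine ((hs1.sub (summable_mul_pow hk1 hs1 (hf t ht))).sub
      ((hs.sub (summable_mul_pow hpnn hs (hf t ht))).mul_left 2)).congr fun k => ?_
    ring
  have hψ' : ∀ t, 0 ≤ t → ψ t = ∑' k : ℕ, ((k : ℝ) - 2) * (p k - p k * f1 t ^ k) :=
    fun t ht => by
      rw [hψ, (hsummable t ht).tsum_eq_zero_add]
      simp only [hζ, rcoord_mul_pow hp0, hp0]
      simp
  have hdiff : ∀ s t, 0 ≤ s → s ≤ t → ψ t - ψ s ≤ 0 ∧ |ψ t - ψ s| ≤ 2 * (t - s) := by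
    intro s t hs0 hst
    have ht0 := hs0.trans hst
    have hab := hanti hs0 ht0 hst
    have h1 := tsum_size_biased_le hpnn hs hmom2 hsub (hf t ht0).1 hab (hf s hs0).2
    have ss := summable_mul_pow hpnn hs (hf s hs0)
    have st := summable_mul_pow hpnn hs (hf t ht0)
    have ks := summable_mul_pow hk1 hs1 (hf s hs0)
    have kt := summable_mul_pow hk1 hs1 (hf t ht0)
    have h2 : ψ t - ψ s = ∑' k : ℕ, ((k : ℝ) - 2) * (p k * f1 s ^ k - p k * f1 t ^ k) := by
      rw [hψ' t ht0, hψ' s hs0, ← (hsummable t ht0).tsum_sub (hsummable s hs0)]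
      exact tsum_congr fun k => by ring
    have h3 : ψ t - ψ s = (∑' k : ℕ, (k : ℝ) * p k * f1 s ^ k - ∑' k : ℕ, (k : ℝ) * p k * f1 t ^ k)
        - 2 * (max (1 - s) 0 - max (1 - t) 0) := by
      rw [h2, ← hG s hs0, ← hG t ht0, ← ks.tsum_sub kt, ← ss.tsum_sub st, ← tsum_mul_left,
        ← (ks.sub kt).tsum_sub ((ss.sub st).mul_left 2)]
      exact tsum_congr fun k => by ring
    have h4 := monotoneOn_tsum_mul_pow hk1 hs1 (hf t ht0) (hf s hs0) hab
    have h5 := max_one_sub_sub_le hst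
    dsimp only at h4
    rw [← h2] at h1
    refine ⟨h1, abs_le.2 ⟨by linarith, by linarith⟩⟩
  have hψ0 : ψ 0 = 0 := by
    rw [hψ' 0 le_rfl]
    simp [hf0]
  have hψlip : ∀ s ∈ Set.Icc (0 : ℝ) T, ∀ t ∈ Set.Icc (0 : ℝ) T, s ≤ t →
      |ψ t - ψ s| ≤ 2 * (t - s) := fun s hs0 t _ hst => (hdiff s t hs0.1 hst).2
  have hζlip : ∀ k, ∀ s ∈ Set.Icc (0 : ℝ) T, ∀ t ∈ Set.Icc (0 : ℝ) T, s ≤ t →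
      |ζ k t - ζ k s| ≤ 1 * (t - s) := fun k s hs0 t _ hst => by
    rw [hζ, hζ]
    exact abs_mul_pow_inverse_sub_le hpnn hs hf hG hanti k hs0.1 hst
  have hCT : memCT T p ζ ψ := by
    refine ⟨fun k => continuousOn_of_lipschitz zero_le_one (hζlip k),
      continuousOn_of_lipschitz zero_le_two hψlip, hψ0, absCont_of_lipschitz two_pos hψlip,
      fun t ht => ?_, fun k hk => ⟨?_, fun t ht => ?_, fun s hs0 t ht hst => ?_,
        absCont_of_lipschitz one_pos (hζlip k)⟩⟩
    · rw [hζ0, skorokhod_eq_zero_of_antitoneOn ht.1 (fun s hs0 t _ hst => ?_) hψ0]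
      linarith [(hdiff s t hs0.1 hst).1]
    · simp [hζ, hf0]
    · rw [hζ]
      exact mul_nonneg (hpnn k) (pow_nonneg (hf t ht.1).1 k)
    · rw [hζ, hζ]
      exact mul_le_mul_of_nonneg_left
        (pow_le_pow_left₀ (hf t ht.1).1 (hanti hs0.1 ht.1 hst) k) (hpnn k)
  refine ⟨hCT, ?_⟩
  have hmeas := measurable_rcoord_inverse hp0 hpnn hs1 hf hanti
  have hcongr : ∀ k t, Set.EqOn
      (fun q : ℝ × ℝ => if 0 ≤ q.2 ∧ q.2 < rcoord (fun j => p j * f1 (max q.1 0) ^ j) k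
        then (1 : ℝ) else 0)
      (fun q : ℝ × ℝ => if 0 ≤ q.2 ∧ q.2 < rcoord (fun j => ζ j q.1) k then (1 : ℝ) else 0)
      (Set.Icc (0 : ℝ) t ×ˢ Set.Icc (0 : ℝ) 1) := fun k t q hq => by
    simp only [hζ, max_eq_left hq.1.1]
  have hB : ∀ k t, 0 ≤ t → Bint ζ (fun _ _ _ => 1) k t = p k - p k * f1 t ^ k :=
    fun k t ht => by
      rw [Bint, ← setIntegral_congr_fun (measurableSet_Icc.prod measurableSet_Icc) (hcongr k t),
        integral_strip_indicator (hmeas k)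
          (fun s => rcoord_mul_pow_mem_Icc hp0 hpnn hs1 (hf _ (le_max_right s 0)) k) t,
        integral_rcoord_inverse hp0 hpnn hs hp1 hs1 hf hG hf0 k ht]
  have hST : memST T p ζ ψ (fun _ _ _ => 1) := by
    refine ⟨fun k => measurable_const, fun _ _ _ => zero_le_one, fun k => ?_, fun t ht => ?_,
      fun t ht k _ => ?_⟩
    · exact (integrableOn_strip_indicator (hmeas k) T).congr_fun (hcongr k T)
        (measurableSet_Icc.prod measurableSet_Icc)
    · rw [hψ' t ht.1]
      exact tsum_congr fun k => by rw [hB k t ht.1]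
    · rw [hB k t ht.1, hζ]
      ring
  rw [rateI, if_pos hCT]
  refine le_antisymm ((iInf₂_le _ hST).trans_eq ?_) zero_le
  simp [costE, ell]
end

section
/- Assume in addition ∑_{k≥1} k²·p_k < ∞. If (ζ^{(1)}, ψ^{(1)}) and (ζ^{(2)}, ψ^{(2)}) are two pairs in C([0,T],ℝ^∞) × C([0,T],ℝ) with I_T(ζ^{(1)}, ψ^{(1)}) = 0 and I_T(ζ^{(2)}, ψ^{(2)}) = 0, then (ζ^{(1)}, ψ^{(1)}) = (ζ^{(2)}, ψ^{(2)}); that is, there is at most one pair at which the rate function I_T vanishes. -/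
open MeasureTheory Filter Topology
open scoped ENNReal

lemma sq_sqrt_sub_one_le_ell {x : ℝ} (hx : 0 ≤ x) : (Real.sqrt x - 1) ^ 2 ≤ ell x := by
  rcases hx.eq_or_lt with rfl | hx
  · simp [ell]
  have hs : 0 < Real.sqrt x := Real.sqrt_pos.2 hx
  have hsq : Real.sqrt x ^ 2 = x := Real.sq_sqrt hx.le
  have hlog : 1 - (Real.sqrt x)⁻¹ ≤ Real.log (Real.sqrt x) := Real.one_sub_inv_le_log_of_pos hs
  have hl : Real.log x = 2 * Real.log (Real.sqrt x) := by
    rw [Real.log_sqrt hx.le]; ring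
  have h1 : Real.sqrt x ^ 2 * (1 - (Real.sqrt x)⁻¹) ≤ Real.sqrt x ^ 2 * Real.log (Real.sqrt x) :=
    mul_le_mul_of_nonneg_left hlog (by positivity)
  have h2 : Real.sqrt x ^ 2 * (1 - (Real.sqrt x)⁻¹) = Real.sqrt x ^ 2 - Real.sqrt x := by
    field_simp
  unfold ell
  rw [hl]
  rw [h2, hsq] at h1
  nlinarith

lemma ell_nonneg {x : ℝ} (hx : 0 ≤ x) : 0 ≤ ell x :=
  (sq_nonneg _).trans (sq_sqrt_sub_one_le_ell hx)

lemma abs_sub_one_le_ell {x ε : ℝ} (hx : 0 ≤ x) (hε : 0 < ε) :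
    |x - 1| ≤ ε + (1 + ε⁻¹) * ell x := by
  set a := |Real.sqrt x - 1| with ha
  have h1 : |x - 1| ≤ a ^ 2 + 2 * a := by
    have : x - 1 = (Real.sqrt x - 1) * ((Real.sqrt x - 1) + 2) := by
      nlinarith [Real.sq_sqrt hx]
    rw [this, abs_mul]
    have h2 : |Real.sqrt x - 1 + 2| ≤ a + 2 := by
      simpa using abs_add_le (Real.sqrt x - 1) 2
    nlinarith [abs_nonneg (Real.sqrt x - 1)]
  have h2 : a ^ 2 ≤ ell x := by
    rw [ha, sq_abs]; exact sq_sqrt_sub_one_le_ell hx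
  have h3 : 2 * a ≤ ε + ε⁻¹ * a ^ 2 := by
    have h4 : ε + ε⁻¹ * a ^ 2 - 2 * a = ε⁻¹ * (ε - a) ^ 2 := by field_simp; ring
    have : 0 ≤ ε⁻¹ * (ε - a) ^ 2 := by positivity
    linarith
  have h5 : ε⁻¹ * a ^ 2 ≤ ε⁻¹ * ell x := mul_le_mul_of_nonneg_left h2 (by positivity)
  linarith

lemma measurable_ell : Measurable ell := by
  unfold ell
  fun_prop

/-- If `φ` has small cost, the integral of `φ` over the region below a graph is close to the area
of that region. -/
lemma abs_setIntegral_sub_le {T t δ ε : ℝ} (ht : t ∈ Set.Icc 0 T) (hε : 0 < ε) (hδ : 0 ≤ δ)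
    {φ : ℝ → ℝ → ℝ} (hφm : Measurable fun q : ℝ × ℝ => φ q.1 q.2) (hφ0 : ∀ s y, 0 ≤ φ s y)
    {R Q : ℝ → ℝ} (hQ : Measurable Q) (hQ0 : ∀ s, 0 ≤ Q s) (hQ1 : ∀ s, Q s ≤ 1)
    (hRQ : ∀ s ∈ Set.Icc 0 T, R s = Q s)
    (hInt : IntegrableOn (fun q : ℝ × ℝ => if 0 ≤ q.2 ∧ q.2 < R q.1 then φ q.1 q.2 else 0)
      (Set.Icc 0 T ×ˢ Set.Icc 0 1))
    (hcost : ∫⁻ q in Set.Icc (0:ℝ) T ×ˢ Set.Icc (0:ℝ) 1, ENNReal.ofReal (ell (φ q.1 q.2))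
      ≤ ENNReal.ofReal δ) :
    |(∫ q in Set.Icc (0:ℝ) t ×ˢ Set.Icc (0:ℝ) 1,
        if 0 ≤ q.2 ∧ q.2 < R q.1 then φ q.1 q.2 else 0) - ∫ s in (0:ℝ)..t, Q s|
      ≤ ε * t + (1 + ε⁻¹) * δ := by
  have hsub : Set.Icc (0:ℝ) t ×ˢ Set.Icc (0:ℝ) 1 ⊆ Set.Icc (0:ℝ) T ×ˢ Set.Icc (0:ℝ) 1 :=
    Set.prod_mono (Set.Icc_subset_Icc_right ht.2) le_rfl
  have hEm : MeasurableSet (Set.Icc (0:ℝ) t ×ˢ Set.Icc (0:ℝ) 1) :=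
    measurableSet_Icc.prod measurableSet_Icc
  have hvol : volume (Set.Icc (0:ℝ) t ×ˢ Set.Icc (0:ℝ) 1) = ENNReal.ofReal t := by
    rw [Measure.volume_eq_prod, Measure.prod_prod]; simp
  have hreal : (volume : Measure (ℝ × ℝ)).real (Set.Icc (0:ℝ) t ×ˢ Set.Icc (0:ℝ) 1) = t := by
    rw [Measure.real, hvol, ENNReal.toReal_ofReal ht.1]
  have hEfin : volume (Set.Icc (0:ℝ) t ×ˢ Set.Icc (0:ℝ) 1) ≠ ⊤ := by
    rw [hvol]; exact ENNReal.ofReal_ne_top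
  have hAm : MeasurableSet {q : ℝ × ℝ | 0 ≤ q.2 ∧ q.2 < Q q.1} :=
    (measurableSet_le measurable_const measurable_snd).inter
      (measurableSet_lt measurable_snd (hQ.comp measurable_fst))
  set g : ℝ × ℝ → ℝ := fun q => if 0 ≤ q.2 ∧ q.2 < Q q.1 then 1 else 0 with hg
  have hgm : Measurable g := Measurable.ite hAm measurable_const measurable_const
  have hgint : IntegrableOn g (Set.Icc (0:ℝ) t ×ˢ Set.Icc (0:ℝ) 1) := by
    refine Measure.integrableOn_of_bounded (M := 1) hEfin hgm.aestronglyMeasurable ?_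
    refine Eventually.of_forall fun q => ?_
    simp only [hg]; split_ifs <;> simp
  have hgval : ∫ q in Set.Icc (0:ℝ) t ×ˢ Set.Icc (0:ℝ) 1, g q = ∫ s in (0:ℝ)..t, Q s := by
    rw [intervalIntegral.integral_of_le ht.1, ← integral_Icc_eq_integral_Ioc,
      Measure.volume_eq_prod, setIntegral_prod _ (by rwa [← Measure.volume_eq_prod])]
    refine setIntegral_congr_fun measurableSet_Icc fun s _ => ?_
    have : (fun y => g (s, y)) = (Set.Ico 0 (Q s)).indicator fun _ => (1:ℝ) := by
      ext y; simp [hg, Set.indicator_apply]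
    simp only [this]
    rw [setIntegral_indicator measurableSet_Ico]
    have hI : Set.Icc (0:ℝ) 1 ∩ Set.Ico 0 (Q s) = Set.Ico 0 (Q s) := by
      refine Set.inter_eq_right.2 fun y hy => ⟨hy.1, hy.2.le.trans (hQ1 s)⟩
    rw [hI]
    simp [hQ0 s]
  have hcost' : ∫⁻ q in Set.Icc (0:ℝ) t ×ˢ Set.Icc (0:ℝ) 1, ENNReal.ofReal (ell (φ q.1 q.2))
      ≤ ENNReal.ofReal δ := (lintegral_mono_set hsub).trans hcost
  have hem : Measurable fun q : ℝ × ℝ => ell (φ q.1 q.2) := measurable_ell.comp hφm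
  have he0 : ∀ q : ℝ × ℝ, 0 ≤ ell (φ q.1 q.2) := fun q => ell_nonneg (hφ0 _ _)
  have heint : IntegrableOn (fun q : ℝ × ℝ => ell (φ q.1 q.2))
      (Set.Icc (0:ℝ) t ×ˢ Set.Icc (0:ℝ) 1) := by
    refine ⟨hem.aestronglyMeasurable, ?_⟩
    rw [hasFiniteIntegral_iff_ofReal (Eventually.of_forall he0)]
    exact hcost'.trans_lt ENNReal.ofReal_lt_top
  have heval : ∫ q in Set.Icc (0:ℝ) t ×ˢ Set.Icc (0:ℝ) 1, ell (φ q.1 q.2) ≤ δ := by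
    rw [integral_eq_lintegral_of_nonneg_ae (Eventually.of_forall he0) hem.aestronglyMeasurable]
    exact ENNReal.toReal_le_of_le_ofReal hδ hcost'
  have hεint : IntegrableOn (fun _ : ℝ × ℝ => ε) (Set.Icc (0:ℝ) t ×ˢ Set.Icc (0:ℝ) 1) :=
    integrableOn_const hEfin
  have hbound : IntegrableOn (fun q : ℝ × ℝ => ε + (1 + ε⁻¹) * ell (φ q.1 q.2))
      (Set.Icc (0:ℝ) t ×ˢ Set.Icc (0:ℝ) 1) :=
    hεint.add (heint.const_mul _)
  rw [← hgval, ← integral_sub (hInt.mono_set hsub) hgint, ← Real.norm_eq_abs]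
  refine (norm_integral_le_of_norm_le hbound ?_).trans ?_
  · refine (ae_restrict_iff' hEm).2 (Eventually.of_forall fun q hq => ?_)
    have hq1 : R q.1 = Q q.1 := hRQ _ (hsub hq).1
    have hpos : 0 ≤ ε + (1 + ε⁻¹) * ell (φ q.1 q.2) := by
      have := he0 q; positivity
    simp only [hg, hq1]
    split_ifs
    · exact abs_sub_one_le_ell (hφ0 _ _) hε
    · simpa using hpos
  · rw [integral_add hεint (heint.const_mul _), integral_const_mul]
    have : 0 ≤ 1 + ε⁻¹ := by positivity
    simp only [setIntegral_const, hreal, smul_eq_mul]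
    nlinarith [mul_le_mul_of_nonneg_left heval this]

lemma rcoord_nonneg {x : ℕ → ℝ} (hx : ∀ k, 0 ≤ x k) (k : ℕ) : 0 ≤ rcoord x k := by
  unfold rcoord
  have := hx k
  split_ifs <;> positivity

lemma le_rtot {x : ℕ → ℝ} (hx : ∀ k, 0 ≤ x k) (hs : Summable fun k : ℕ => (k : ℝ) * x k) (k : ℕ) :
    (if k = 0 then max (x 0) 0 else (k : ℝ) * x k) ≤ rtot x := by
  have h0 : ∀ j : ℕ, 0 ≤ (j : ℝ) * x j := fun j => mul_nonneg j.cast_nonneg (hx j)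
  unfold rtot
  split_ifs
  · exact le_add_of_nonneg_right (tsum_nonneg h0)
  · exact (hs.le_tsum k fun j _ => h0 j).trans (le_add_of_nonneg_left (le_max_right _ _))

lemma rcoord_le_one {x : ℕ → ℝ} (hx : ∀ k, 0 ≤ x k) (hs : Summable fun k : ℕ => (k : ℝ) * x k)
    (k : ℕ) : rcoord x k ≤ 1 := by
  unfold rcoord
  rw [apply_ite (· ≤ (1:ℝ))]
  split_ifs with h
  · have := le_rtot hx hs k
    simp_all [div_le_one]
  · have := le_rtot hx hs k
    simp_all [div_le_one]
  · exact zero_le_one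

/-- The deterministic limit equations, for paths extended continuously to all of `ℝ`. -/
structure IsFluidLimit (T : ℝ) (p : ℕ → ℝ) (ζ : ℕ → ℝ → ℝ) (ψ : ℝ → ℝ) : Prop where
  cont : ∀ k, Continuous (ζ k)
  cont_psi : Continuous ψ
  nonneg : ∀ k t, 0 ≤ ζ k t
  le : ∀ k t, 1 ≤ k → ζ k t ≤ p k
  psi_zero : ψ 0 = 0
  zero_eq : ∀ t ∈ Set.Icc 0 T, ζ 0 t = skorokhod ψ t
  anti : ∀ k, 1 ≤ k → AntitoneOn (ζ k) (Set.Icc 0 T)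
  eq : ∀ k, 1 ≤ k → ∀ t ∈ Set.Icc 0 T,
    ζ k t = p k - ∫ s in (0:ℝ)..t, rcoord (fun j => ζ j s) k
  psi_eq : ∀ t ∈ Set.Icc 0 T,
    ψ t = -2 * (∫ s in (0:ℝ)..t, rcoord (fun j => ζ j s) 0)
      + ∑' k : ℕ, if k = 0 then 0 else ((k : ℝ) - 2) * (p k - ζ k t)

section Paths

variable {p : ℕ → ℝ} {ζ : ℕ → ℝ → ℝ}

lemma summable_mul_path (hp : Summable fun k : ℕ => (k : ℝ) * p k)
    (h0 : ∀ k t, 0 ≤ ζ k t) (hle : ∀ k t, 1 ≤ k → ζ k t ≤ p k) (t : ℝ) :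
    Summable fun k : ℕ => (k : ℝ) * ζ k t := by
  refine hp.of_nonneg_of_le (fun k => mul_nonneg k.cast_nonneg (h0 k t)) fun k => ?_
  rcases Nat.eq_zero_or_pos k with rfl | hk
  · simp
  · exact mul_le_mul_of_nonneg_left (hle k t hk) k.cast_nonneg

lemma continuous_rtot (hp : Summable fun k : ℕ => (k : ℝ) * p k) (hc : ∀ k, Continuous (ζ k))
    (h0 : ∀ k t, 0 ≤ ζ k t) (hle : ∀ k t, 1 ≤ k → ζ k t ≤ p k) :
    Continuous fun s => rtot fun j => ζ j s := by
  unfold rtot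
  refine ((hc 0).max continuous_const).add ?_
  refine continuous_tsum (fun k => continuous_const.mul (hc k)) hp fun k t => ?_
  rw [Real.norm_of_nonneg (mul_nonneg k.cast_nonneg (h0 k t))]
  rcases Nat.eq_zero_or_pos k with rfl | hk
  · simp
  · exact mul_le_mul_of_nonneg_left (hle k t hk) k.cast_nonneg

lemma measurable_rcoord (hp : Summable fun k : ℕ => (k : ℝ) * p k) (hc : ∀ k, Continuous (ζ k))
    (h0 : ∀ k t, 0 ≤ ζ k t) (hle : ∀ k t, 1 ≤ k → ζ k t ≤ p k) (k : ℕ) :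
    Measurable fun s => rcoord (fun j => ζ j s) k := by
  have hr := (continuous_rtot hp hc h0 hle).measurable
  have hm : ∀ j, Measurable (ζ j) := fun j => (hc j).measurable
  unfold rcoord
  refine Measurable.ite (measurableSet_lt measurable_const hr) (Measurable.div ?_ hr)
    measurable_const
  by_cases hk : k = 0
  · simpa [hk] using (hm 0).max measurable_const
  · simpa [hk] using (hm k).const_mul (k : ℝ)

lemma intervalIntegrable_rcoord (hp : Summable fun k : ℕ => (k : ℝ) * p k)
    (hc : ∀ k, Continuous (ζ k)) (h0 : ∀ k t, 0 ≤ ζ k t) (hle : ∀ k t, 1 ≤ k → ζ k t ≤ p k)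
    (k : ℕ) (a b : ℝ) :
    IntervalIntegrable (fun s => rcoord (fun j => ζ j s) k) volume a b := by
  refine (intervalIntegrable_const (c := (1:ℝ))).mono_fun
    (measurable_rcoord hp hc h0 hle k).aestronglyMeasurable (Eventually.of_forall fun s => ?_)
  beta_reduce
  rw [Real.norm_of_nonneg (rcoord_nonneg (fun j => h0 j s) k)]
  simpa using rcoord_le_one (fun j => h0 j s) (summable_mul_path hp h0 hle s) k

end Paths

lemma summable_sub_two_mul {p x : ℕ → ℝ} (hp : Summable fun k : ℕ => (k : ℝ) * p k)
    (h0 : ∀ k, 1 ≤ k → 0 ≤ x k) (hle : ∀ k, 1 ≤ k → x k ≤ p k) :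
    Summable fun k : ℕ => if k = 0 then 0 else ((k : ℝ) - 2) * (p k - x k) := by
  refine hp.of_norm_bounded fun k => ?_
  rcases Nat.eq_zero_or_pos k with rfl | hk
  · simp
  · have h1 : (1:ℝ) ≤ k := by exact_mod_cast hk
    rw [if_neg hk.ne', norm_mul, Real.norm_eq_abs, Real.norm_eq_abs,
      abs_of_nonneg (sub_nonneg.2 (hle k hk))]
    refine mul_le_mul (abs_le.2 ⟨by linarith, by linarith⟩) ?_ (sub_nonneg.2 (hle k hk))
      (by positivity)
    linarith [h0 k hk]

lemma skorokhod_nonneg {T : ℝ} {ψ : ℝ → ℝ} (hψ : ContinuousOn ψ (Set.Icc 0 T)) {t : ℝ}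
    (ht : t ∈ Set.Icc 0 T) : 0 ≤ skorokhod ψ t := by
  have hb : BddBelow (ψ '' Set.Icc 0 t) :=
    (isCompact_Icc.image_of_continuousOn (hψ.mono (Set.Icc_subset_Icc_right ht.2))).bddBelow
  have : sInf (ψ '' Set.Icc 0 t) ≤ ψ t := csInf_le hb ⟨t, ⟨ht.1, le_rfl⟩, rfl⟩
  unfold skorokhod
  linarith [min_le_left (sInf (ψ '' Set.Icc 0 t)) 0]

lemma exists_memST_of_rateI_eq_zero {T : ℝ} {p : ℕ → ℝ} {ζ : ℕ → ℝ → ℝ} {ψ : ℝ → ℝ}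
    (h : rateI T p ζ ψ = 0) : memCT T p ζ ψ ∧
      ∀ δ : ℝ, 0 < δ → ∃ φ, memST T p ζ ψ φ ∧ costE T φ ≤ ENNReal.ofReal δ := by
  unfold rateI at h
  split_ifs at h with hC
  · refine ⟨hC, fun δ hδ => ?_⟩
    have : (⨅ (φ : ℕ → ℝ → ℝ → ℝ) (_ : memST T p ζ ψ φ), costE T φ) < ENNReal.ofReal δ := by
      rw [h]; simpa using hδ
    simp only [iInf_lt_iff] at this
    obtain ⟨φ, hφ, hlt⟩ := this
    exact ⟨φ, hφ, hlt.le⟩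
  · exact absurd h ENNReal.top_ne_zero

lemma eq_of_forall_abs_sub_le {x y t : ℝ} (ht : 0 ≤ t)
    (h : ∀ ε > 0, ∀ δ > 0, |x - y| ≤ ε * t + (1 + ε⁻¹) * δ) : x = y := by
  refine eq_of_abs_sub_nonpos (le_of_forall_pos_le_add fun η hη => ?_)
  have hε : 0 < η / (2 * (t + 1)) := by positivity
  set ε := η / (2 * (t + 1)) with hεd
  have hδ : 0 < (1 + ε⁻¹)⁻¹ * (η / 2) := by positivity
  refine (h ε hε _ hδ).trans ?_
  have h1 : (1 + ε⁻¹) * ((1 + ε⁻¹)⁻¹ * (η / 2)) = η / 2 := by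
    rw [← mul_assoc, mul_inv_cancel₀ (by positivity), one_mul]
  have h2 : ε * (t + 1) = η / 2 := by rw [hεd]; field_simp
  rw [h1]
  nlinarith

/-- A pair of zero rate solves the deterministic limit equations. -/
lemma isFluidLimit_of_rateI_eq_zero {T : ℝ} (hT : 0 < T) {p : ℕ → ℝ}
    (hmom : Summable fun k : ℕ => (k : ℝ) * p k) {ζ : ℕ → ℝ → ℝ} {ψ : ℝ → ℝ}
    (h : rateI T p ζ ψ = 0) :
    IsFluidLimit T p (fun k => Set.IccExtend hT.le ((Set.Icc 0 T).domRestrict (ζ k)))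
      (Set.IccExtend hT.le ((Set.Icc 0 T).domRestrict ψ)) := by
  obtain ⟨⟨hζc, hψc, hψ0, -, hζ0, hζk⟩, hex⟩ := exists_memST_of_rateI_eq_zero h
  set z : ℕ → ℝ → ℝ := fun k => Set.IccExtend hT.le ((Set.Icc 0 T).domRestrict (ζ k)) with hz
  set w : ℝ → ℝ := Set.IccExtend hT.le ((Set.Icc 0 T).domRestrict ψ) with hw
  have hzeq : ∀ k, ∀ t ∈ Set.Icc 0 T, z k t = ζ k t := fun k t ht => by
    simp only [hz, Set.IccExtend_of_mem hT.le _ ht, Set.domRestrict_apply]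
  have hweq : ∀ t ∈ Set.Icc 0 T, w t = ψ t := fun t ht => by
    simp only [hw, Set.IccExtend_of_mem hT.le _ ht, Set.domRestrict_apply]
  have h00 : (0:ℝ) ∈ Set.Icc 0 T := ⟨le_rfl, hT.le⟩
  have hnn : ∀ k, ∀ t ∈ Set.Icc 0 T, 0 ≤ ζ k t := fun k t ht => by
    rcases Nat.eq_zero_or_pos k with rfl | hk
    · rw [hζ0 t ht]; exact skorokhod_nonneg hψc ht
    · exact (hζk k hk).2.1 t ht
  have hle : ∀ k, ∀ t ∈ Set.Icc 0 T, 1 ≤ k → ζ k t ≤ p k := fun k t ht hk => by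
    rw [← (hζk k hk).1]; exact (hζk k hk).2.2.1 h00 ht ht.1
  have zc : ∀ k, Continuous (z k) := fun k => (hζc k).domRestrict.Icc_extend'
  have znn : ∀ k t, 0 ≤ z k t := fun k t => hnn k _ (Set.projIcc 0 T hT.le t).2
  have zle : ∀ k t, 1 ≤ k → z k t ≤ p k := fun k t hk => hle k _ (Set.projIcc 0 T hT.le t).2 hk
  have hR : ∀ k, ∀ s ∈ Set.Icc 0 T, rcoord (fun j => ζ j s) k = rcoord (fun j => z j s) k :=
    fun k s hs => by simp only [hzeq _ s hs]
  have key : ∀ t ∈ Set.Icc 0 T, ∀ k, ∀ x : ℝ, (∀ φ, memST T p ζ ψ φ → Bint ζ φ k t = x) →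
      x = ∫ s in (0:ℝ)..t, rcoord (fun j => z j s) k := by
    intro t ht k x hx
    refine eq_of_forall_abs_sub_le ht.1 fun ε hε δ hδ => ?_
    obtain ⟨φ, hφ, hcost⟩ := hex δ hδ
    rw [← hx φ hφ]
    exact abs_setIntegral_sub_le ht hε hδ.le (hφ.1 k) (hφ.2.1 k)
      (measurable_rcoord hmom zc znn zle k) (fun s => rcoord_nonneg (fun j => znn j s) k)
      (fun s => rcoord_le_one (fun j => znn j s) (summable_mul_path hmom znn zle s) k)
      (hR k) (hφ.2.2.1 k) ((ENNReal.le_tsum k).trans hcost)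
  have hB : ∀ t ∈ Set.Icc 0 T, ∀ k, 1 ≤ k → ∀ φ, memST T p ζ ψ φ →
      Bint ζ φ k t = p k - ζ k t := fun t ht k hk φ hφ => by
    rw [hφ.2.2.2.2 t ht k hk]; ring
  have hsum : ∀ t ∈ Set.Icc 0 T,
      Summable fun k : ℕ => if k = 0 then 0 else ((k : ℝ) - 2) * (p k - ζ k t) :=
    fun t ht => summable_sub_two_mul hmom (fun k _ => hnn k t ht) fun k hk => hle k t ht hk
  have hB0 : ∀ t ∈ Set.Icc 0 T, ∀ φ, memST T p ζ ψ φ →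
      ψ t = -2 * Bint ζ φ 0 t
        + ∑' k : ℕ, if k = 0 then 0 else ((k : ℝ) - 2) * (p k - ζ k t) := by
    intro t ht φ hφ
    have hfun : (fun k : ℕ => if k = 0 then 0 else ((k : ℝ) - 2) * (p k - ζ k t))
        = Function.update (fun k : ℕ => ((k : ℝ) - 2) * Bint ζ φ k t) 0 0 := by
      ext k
      by_cases hk : k = 0
      · simp [hk]
      · simp [hk, hB t ht k (Nat.one_le_iff_ne_zero.2 hk) φ hφ]
    have hs : Summable fun k : ℕ => ((k : ℝ) - 2) * Bint ζ φ k t := by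
      have h1 := (hsum t ht).update 0 (((0 : ℕ) - 2 : ℝ) * Bint ζ φ 0 t)
      rw [hfun, Function.update_idem] at h1
      rwa [Function.update_eq_self_iff.2] at h1
      simp
    rw [hφ.2.2.2.1 t ht, hs.tsum_eq_add_tsum_ite 0]
    congr 1
    · simp
    · refine tsum_congr fun k => ?_
      by_cases hk : k = 0
      · simp [hk]
      · simp [hk, hB t ht k (Nat.one_le_iff_ne_zero.2 hk) φ hφ]
  refine ⟨zc, hψc.domRestrict.Icc_extend', znn, zle, ?_, ?_, ?_, ?_, ?_⟩
  · rw [hweq 0 h00, hψ0]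
  · intro t ht
    have himg : w '' Set.Icc 0 t = ψ '' Set.Icc 0 t :=
      Set.image_congr fun s hs => hweq s ⟨hs.1, hs.2.trans ht.2⟩
    change z 0 t = _
    rw [hzeq 0 t ht, hζ0 t ht, skorokhod, skorokhod, himg, hweq t ht]
  · intro k hk s hs t ht hst
    change z k t ≤ z k s
    rw [hzeq k s hs, hzeq k t ht]
    exact (hζk k hk).2.2.1 hs ht hst
  · intro k hk t ht
    rw [← key t ht k _ (hB t ht k hk), hzeq k t ht]
    ring
  · intro t ht
    simp only [hweq t ht, hzeq _ t ht]
    rw [← key t ht 0 (((∑' k : ℕ, if k = 0 then 0 else ((k : ℝ) - 2) * (p k - ζ k t)) - ψ t) / 2)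
      fun φ hφ => by linarith [hB0 t ht φ hφ]]
    ring

lemma abs_skorokhod_sub_le {ψ₁ ψ₂ : ℝ → ℝ} (h₁ : Continuous ψ₁) (h₂ : Continuous ψ₂) {t b : ℝ}
    (ht : 0 ≤ t) (hb : ∀ s ∈ Set.Icc 0 t, |ψ₁ s - ψ₂ s| ≤ b) :
    |skorokhod ψ₁ t - skorokhod ψ₂ t| ≤ 2 * b := by
  have inf_le : ∀ f g : ℝ → ℝ, Continuous f → (∀ s ∈ Set.Icc 0 t, f s ≤ g s + b) →
      sInf (f '' Set.Icc 0 t) ≤ sInf (g '' Set.Icc 0 t) + b := by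
    intro f g hf hfg
    rw [← sub_le_iff_le_add]
    refine le_csInf ((Set.nonempty_Icc.2 ht).image g) ?_
    rintro _ ⟨s, hs, rfl⟩
    have : sInf (f '' Set.Icc 0 t) ≤ f s :=
      csInf_le (isCompact_Icc.image hf).bddBelow ⟨s, hs, rfl⟩
    linarith [hfg s hs]
  have h12 := inf_le ψ₁ ψ₂ h₁ fun s hs => by linarith [(abs_le.1 (hb s hs)).2]
  have h21 := inf_le ψ₂ ψ₁ h₂ fun s hs => by linarith [(abs_le.1 (hb s hs)).1]
  have hmin : |min (sInf (ψ₁ '' Set.Icc 0 t)) 0 - min (sInf (ψ₂ '' Set.Icc 0 t)) 0| ≤ b := by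
    refine (abs_min_sub_min_le_max _ _ _ _).trans (max_le (abs_le.2 ⟨by linarith, by linarith⟩) ?_)
    simpa using (abs_nonneg _).trans (hb t ⟨ht, le_rfl⟩)
  have h := hb t ⟨ht, le_rfl⟩
  rw [abs_le] at *
  unfold skorokhod
  constructor <;> linarith

lemma abs_exp_neg_sub_le {a b : ℝ} (ha : 0 ≤ a) (hb : 0 ≤ b) :
    |Real.exp (-a) - Real.exp (-b)| ≤ |a - b| := by
  wlog hab : a ≤ b generalizing a b
  · rw [abs_sub_comm, abs_sub_comm a]
    exact this hb ha (le_of_not_ge hab)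
  have h1 : Real.exp (-b) ≤ Real.exp (-a) := Real.exp_le_exp.2 (by linarith)
  rw [abs_of_nonneg (by linarith), abs_of_nonpos (by linarith)]
  have h2 : Real.exp (-b) = Real.exp (-a) * Real.exp (-(b - a)) := by
    rw [← Real.exp_add]; ring_nf
  have h3 : 1 - (b - a) ≤ Real.exp (-(b - a)) := by
    linarith [Real.add_one_le_exp (-(b - a))]
  have h4 : Real.exp (-a) ≤ 1 := Real.exp_le_one_iff.2 (by linarith)
  have h5 : 0 < Real.exp (-a) := Real.exp_pos _
  rw [h2]
  have h6 : Real.exp (-a) * (1 - (b - a)) ≤ Real.exp (-a) * Real.exp (-(b - a)) :=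
    mul_le_mul_of_nonneg_left h3 h5.le
  nlinarith

lemma abs_tsum_sub_tsum_le {f g h : ℕ → ℝ} (hf : Summable f) (hg : Summable g) (hh : Summable h)
    (hle : ∀ k, |f k - g k| ≤ h k) : |∑' k, f k - ∑' k, g k| ≤ ∑' k, h k := by
  rw [← hf.tsum_sub hg, ← Real.norm_eq_abs]
  exact tsum_of_norm_bounded hh.hasSum hle

/-- The total rate along a path. -/
noncomputable def totalRate (ζ : ℕ → ℝ → ℝ) (s : ℝ) : ℝ := rtot fun j => ζ j s

/-- The operational time of a path, with the total rate truncated below at `c`. -/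
noncomputable def clock (ζ : ℕ → ℝ → ℝ) (c t : ℝ) : ℝ :=
  ∫ s in (0:ℝ)..t, (max (totalRate ζ s) c)⁻¹

namespace IsFluidLimit

variable {T : ℝ} {p : ℕ → ℝ} {ζ : ℕ → ℝ → ℝ} {ψ : ℝ → ℝ}

lemma continuous_totalRate (h : IsFluidLimit T p ζ ψ) (hp : Summable fun k : ℕ => (k : ℝ) * p k) :
    Continuous (totalRate ζ) :=
  continuous_rtot hp h.cont h.nonneg h.le

lemma totalRate_eq (h : IsFluidLimit T p ζ ψ) (s : ℝ) :
    totalRate ζ s = ζ 0 s + ∑' k : ℕ, (k : ℝ) * ζ k s := by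
  simp [totalRate, rtot, h.nonneg 0 s]

lemma continuous_inv_max (h : IsFluidLimit T p ζ ψ) (hp : Summable fun k : ℕ => (k : ℝ) * p k)
    {c : ℝ} (hc : 0 < c) : Continuous fun s => (max (totalRate ζ s) c)⁻¹ :=
  ((h.continuous_totalRate hp).max continuous_const).inv₀ fun _ =>
    (hc.trans_le (le_max_right _ _)).ne'

lemma clock_nonneg {c t : ℝ} (hc : 0 < c) (ht : 0 ≤ t) : 0 ≤ clock ζ c t :=
  intervalIntegral.integral_nonneg ht fun _ _ =>
    inv_nonneg.2 (hc.le.trans (le_max_right _ _))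

/-- While the total rate is positive, the degree-`k` mass decays exponentially in operational
time. -/
lemma eq_mul_exp (h : IsFluidLimit T p ζ ψ) (hp : Summable fun k : ℕ => (k : ℝ) * p k)
    {c τ : ℝ} (hc : 0 < c) (hτ : τ ∈ Set.Icc 0 T) (hr : ∀ s ∈ Set.Icc 0 τ, c ≤ totalRate ζ s)
    {k : ℕ} (hk : 1 ≤ k) {t : ℝ} (ht : t ∈ Set.Icc 0 τ) :
    ζ k t = p k * Real.exp (-(k * clock ζ c t)) := by
  set ρ : ℝ → ℝ := fun s => (max (totalRate ζ s) c)⁻¹ with hρ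
  have hρc : Continuous ρ := h.continuous_inv_max hp hc
  have hgc : Continuous fun s => (k : ℝ) * ζ k s * ρ s :=
    (continuous_const.mul (h.cont k)).mul hρc
  set Z : ℝ → ℝ := fun t => p k - ∫ s in (0:ℝ)..t, (k : ℝ) * ζ k s * ρ s with hZ
  have hZeq : ∀ u ∈ Set.Icc 0 τ, Z u = ζ k u := by
    intro u hu
    rw [h.eq k hk u ⟨hu.1, hu.2.trans hτ.2⟩]
    simp only [hZ]
    congr 1
    refine intervalIntegral.integral_congr fun s hs => ?_
    rw [Set.uIcc_of_le hu.1] at hs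
    have hcs := hr s ⟨hs.1, hs.2.trans hu.2⟩
    have hpos : 0 < rtot fun j => ζ j s := hc.trans_le hcs
    simp only [hρ, max_eq_left hcs, rcoord, if_pos hpos, if_neg (Nat.one_le_iff_ne_zero.1 hk)]
    rw [div_eq_mul_inv, totalRate]
  have hZd : ∀ u, HasDerivAt Z (-((k : ℝ) * ζ k u * ρ u)) u := fun u =>
    (hgc.integral_hasStrictDerivAt 0 u).hasDerivAt.const_sub (p k)
  have hSd : ∀ u, HasDerivAt (clock ζ c) (ρ u) u := fun u =>
    (hρc.integral_hasStrictDerivAt 0 u).hasDerivAt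
  have hFd : ∀ u, HasDerivAt (fun u => Z u * Real.exp (k * clock ζ c u))
      (-((k : ℝ) * ζ k u * ρ u) * Real.exp (k * clock ζ c u)
        + Z u * (Real.exp (k * clock ζ c u) * (k * ρ u))) u := fun u =>
    (hZd u).mul ((hSd u).const_mul (k : ℝ)).exp
  have hconst := constant_of_has_deriv_right_zero (a := 0) (b := τ)
    (fun u _ => (hFd u).continuousAt.continuousWithinAt)
    (fun u hu => by
      have h1 := (hFd u).hasDerivWithinAt (s := Set.Ici u)
      rw [hZeq u ⟨hu.1, hu.2.le⟩] at h1
      convert h1 using 1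
      ring) t ht
  have h0 : Z 0 = p k := by simp [hZ]
  have hS0 : clock ζ c 0 = 0 := by simp [clock]
  rw [hZeq t ht, h0, hS0, mul_zero, Real.exp_zero, mul_one] at hconst
  rw [← hconst, mul_assoc, ← Real.exp_add, add_neg_cancel, Real.exp_zero, mul_one]

end IsFluidLimit

/-- Weighted differences of two paths are controlled by the difference of their clocks. -/
lemma abs_mul_sub_le_of_eq_exp {k : ℕ} {q a b x y v : ℝ} (hq : 0 ≤ q) (ha : 0 ≤ a) (hb : 0 ≤ b)
    (hx : x = q * Real.exp (-(k * a))) (hy : y = q * Real.exp (-(k * b))) (hv : |v| ≤ k) :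
    |v * (x - y)| ≤ (k : ℝ) ^ 2 * q * |a - b| := by
  have hk : (0:ℝ) ≤ k := k.cast_nonneg
  have h1 := abs_exp_neg_sub_le (mul_nonneg hk ha) (mul_nonneg hk hb)
  rw [← mul_sub, abs_mul (k:ℝ), abs_of_nonneg hk] at h1
  rw [hx, hy, ← mul_sub, abs_mul, abs_mul, abs_of_nonneg hq]
  calc |v| * (q * |Real.exp (-(k * a)) - Real.exp (-(k * b))|)
      ≤ k * (q * (k * |a - b|)) := by gcongr
    _ = _ := by ring

lemma abs_div_sub_div_le {c x y r s : ℝ} (hc : 0 < c) (hr : c ≤ r) (hs : c ≤ s) (hy : 0 ≤ y)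
    (hys : y ≤ s) : |x / r - y / s| ≤ (|x - y| + |r - s|) / c := by
  have hr0 : 0 < r := hc.trans_le hr
  have hs0 : 0 < s := hc.trans_le hs
  have h1 : x / r - y / s = (x - y) / r + (y / s) * ((s - r) / r) := by field_simp; ring
  have h2 : |(x - y) / r| ≤ |x - y| / c := by
    rw [abs_div, abs_of_pos hr0]; gcongr
  have h3 : |(y / s) * ((s - r) / r)| ≤ |r - s| / c := by
    rw [abs_mul, abs_div (s - r), abs_of_pos hr0, abs_of_nonneg (by positivity), abs_sub_comm s r]
    calc y / s * (|r - s| / r) ≤ 1 * (|r - s| / c) := by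
          gcongr
          exact (div_le_one hs0).2 hys
      _ = _ := one_mul _
  rw [h1, add_div]
  exact (abs_add_le _ _).trans (add_le_add h2 h3)

lemma abs_inv_sub_inv_le {c r s : ℝ} (hc : 0 < c) (hr : c ≤ r) (hs : c ≤ s) :
    |r⁻¹ - s⁻¹| ≤ |r - s| / c ^ 2 := by
  have hr0 : 0 < r := hc.trans_le hr
  have hs0 : 0 < s := hc.trans_le hs
  rw [inv_sub_inv hr0.ne' hs0.ne', abs_div, abs_of_pos (mul_pos hr0 hs0), abs_sub_comm]
  gcongr
  nlinarith

/-- Integrating an exponential majorant gains a factor `L⁻¹`. -/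
lemma abs_integral_sub_le_exp {f g : ℝ → ℝ} {C L t : ℝ} (hC : 0 ≤ C) (hL : 0 < L) (ht : 0 ≤ t)
    (hf : IntervalIntegrable f volume 0 t) (hg : IntervalIntegrable g volume 0 t)
    (hfg : ∀ s ∈ Set.Icc 0 t, |f s - g s| ≤ C * Real.exp (L * s)) :
    |(∫ s in (0:ℝ)..t, f s) - ∫ s in (0:ℝ)..t, g s| ≤ C / L * Real.exp (L * t) := by
  rw [← intervalIntegral.integral_sub hf hg, ← Real.norm_eq_abs]
  have hc : Continuous fun s => C * Real.exp (L * s) := by fun_prop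
  refine (intervalIntegral.norm_integral_le_of_norm_le ht
    (Eventually.of_forall fun s hs => hfg s ⟨hs.1.le, hs.2⟩) (hc.intervalIntegrable _ _)).trans ?_
  have hd : ∀ s ∈ Set.uIcc 0 t,
      HasDerivAt (fun s => C / L * Real.exp (L * s)) (C * Real.exp (L * s)) s := fun s _ => by
    have h1 := (((hasDerivAt_id s).const_mul L).exp).const_mul (C / L)
    have h2 : C / L * (Real.exp (L * s) * (L * 1)) = C * Real.exp (L * s) := by field_simp
    rw [← h2]
    exact h1
  rw [intervalIntegral.integral_eq_sub_of_hasDerivAt hd (hc.intervalIntegrable _ _)]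
  have : 0 ≤ C / L * Real.exp (L * 0) := by positivity
  linarith

namespace IsFluidLimit

variable {T : ℝ} {p : ℕ → ℝ} {ζ₁ ζ₂ : ℕ → ℝ → ℝ} {ψ₁ ψ₂ : ℝ → ℝ}

/-- One contraction step: an exponential bound on the distance of two solutions improves by a
factor `2`. -/
lemma dist_le_half (h₁ : IsFluidLimit T p ζ₁ ψ₁) (h₂ : IsFluidLimit T p ζ₂ ψ₂)
    (hpnn : ∀ k, 0 ≤ p k) (hp : Summable fun k : ℕ => (k : ℝ) * p k)
    (hmom2 : Summable fun k : ℕ => (k : ℝ) ^ 2 * p k)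
    {c τ : ℝ} (hc : 0 < c) (hτ : τ ∈ Set.Icc 0 T)
    (hr₁ : ∀ s ∈ Set.Icc 0 τ, c ≤ totalRate ζ₁ s) (hr₂ : ∀ s ∈ Set.Icc 0 τ, c ≤ totalRate ζ₂ s)
    {K L M : ℝ} (hK : K = ∑' k : ℕ, (k : ℝ) ^ 2 * p k)
    (hL : L = 2 * ((2 + K) / c ^ 2 + K * ((2 + K) / c ^ 2) + 2 * ((4 + K) / c))) (hM : 0 ≤ M)
    (hS : ∀ s ∈ Set.Icc 0 τ, |clock ζ₁ c s - clock ζ₂ c s| ≤ M * Real.exp (L * s))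
    (hψ : ∀ s ∈ Set.Icc 0 τ, |ψ₁ s - ψ₂ s| ≤ M * Real.exp (L * s)) :
    ∀ t ∈ Set.Icc 0 τ, |clock ζ₁ c t - clock ζ₂ c t| ≤ M / 2 * Real.exp (L * t) ∧
      |ψ₁ t - ψ₂ t| ≤ M / 2 * Real.exp (L * t) := by
  have hK0 : 0 ≤ K := hK ▸ tsum_nonneg fun k => mul_nonneg (by positivity) (hpnn k)
  have hL0 : 0 < L := by rw [hL]; positivity
  have hT : ∀ s ∈ Set.Icc 0 τ, s ∈ Set.Icc 0 T := fun s hs => ⟨hs.1, hs.2.trans hτ.2⟩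
  have hterm : ∀ s ∈ Set.Icc 0 τ, ∀ k : ℕ, 1 ≤ k → ∀ v : ℝ, |v| ≤ k →
      |v * (ζ₁ k s - ζ₂ k s)| ≤ (k : ℝ) ^ 2 * p k * |clock ζ₁ c s - clock ζ₂ c s| :=
    fun s hs k hk v hv => abs_mul_sub_le_of_eq_exp (hpnn k) (clock_nonneg hc hs.1)
      (clock_nonneg hc hs.1) (h₁.eq_mul_exp hp hc hτ hr₁ hk hs)
      (h₂.eq_mul_exp hp hc hτ hr₂ hk hs) hv
  have hG : ∀ s ∈ Set.Icc 0 τ, |∑' k : ℕ, (k : ℝ) * ζ₁ k s - ∑' k : ℕ, (k : ℝ) * ζ₂ k s|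
      ≤ K * |clock ζ₁ c s - clock ζ₂ c s| := by
    intro s hs
    rw [hK, ← tsum_mul_right]
    refine abs_tsum_sub_tsum_le (summable_mul_path hp h₁.nonneg h₁.le s)
      (summable_mul_path hp h₂.nonneg h₂.le s) (hmom2.mul_right _) fun k => ?_
    rcases Nat.eq_zero_or_pos k with rfl | hk
    · simp
    · rw [← mul_sub]
      exact hterm s hs k hk k (by simp)
  have hW : ∀ s ∈ Set.Icc 0 τ,
      |(∑' k : ℕ, if k = 0 then 0 else ((k : ℝ) - 2) * (p k - ζ₁ k s))
        - ∑' k : ℕ, if k = 0 then 0 else ((k : ℝ) - 2) * (p k - ζ₂ k s)|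
      ≤ K * |clock ζ₁ c s - clock ζ₂ c s| := by
    intro s hs
    rw [hK, ← tsum_mul_right]
    refine abs_tsum_sub_tsum_le
      (summable_sub_two_mul hp (fun k _ => h₁.nonneg k s) fun k hk => h₁.le k s hk)
      (summable_sub_two_mul hp (fun k _ => h₂.nonneg k s) fun k hk => h₂.le k s hk)
      (hmom2.mul_right _) fun k => ?_
    rcases Nat.eq_zero_or_pos k with rfl | hk
    · simp
    · have h1 : (1:ℝ) ≤ k := by exact_mod_cast hk
      have h2 := hterm s hs k hk (2 - k) (abs_le.2 ⟨by linarith, by linarith⟩)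
      rw [if_neg hk.ne', if_neg hk.ne']
      convert h2 using 2
      ring
  have hΓ : ∀ s ∈ Set.Icc 0 τ, |ζ₁ 0 s - ζ₂ 0 s| ≤ 2 * (M * Real.exp (L * s)) := by
    intro s hs
    rw [h₁.zero_eq s (hT s hs), h₂.zero_eq s (hT s hs)]
    refine abs_skorokhod_sub_le h₁.cont_psi h₂.cont_psi hs.1 fun u hu => ?_
    refine (hψ u ⟨hu.1, hu.2.trans hs.2⟩).trans ?_
    have := hu.2
    gcongr
  have hr : ∀ s ∈ Set.Icc 0 τ,
      |totalRate ζ₁ s - totalRate ζ₂ s| ≤ (2 + K) * (M * Real.exp (L * s)) := by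
    intro s hs
    rw [h₁.totalRate_eq, h₂.totalRate_eq, add_sub_add_comm]
    refine (abs_add_le _ _).trans ?_
    have := mul_le_mul_of_nonneg_left (hS s hs) hK0
    linarith [hΓ s hs, hG s hs]
  have hclock : ∀ t ∈ Set.Icc 0 τ, |clock ζ₁ c t - clock ζ₂ c t|
      ≤ (2 + K) / c ^ 2 * M / L * Real.exp (L * t) := by
    intro t ht
    refine abs_integral_sub_le_exp (by positivity) hL0 ht.1
      ((h₁.continuous_inv_max hp hc).intervalIntegrable _ _)
      ((h₂.continuous_inv_max hp hc).intervalIntegrable _ _) fun s hs => ?_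
    have hs' : s ∈ Set.Icc 0 τ := ⟨hs.1, hs.2.trans ht.2⟩
    rw [max_eq_left (hr₁ s hs'), max_eq_left (hr₂ s hs')]
    refine (abs_inv_sub_inv_le hc (hr₁ s hs') (hr₂ s hs')).trans ?_
    calc _ ≤ (2 + K) * (M * Real.exp (L * s)) / c ^ 2 := by gcongr; exact hr s hs'
      _ = _ := by ring
  have hInt : ∀ t ∈ Set.Icc 0 τ, |(∫ s in (0:ℝ)..t, rcoord (fun j => ζ₁ j s) 0)
      - ∫ s in (0:ℝ)..t, rcoord (fun j => ζ₂ j s) 0| ≤ (4 + K) / c * M / L * Real.exp (L * t) := by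
    intro t ht
    refine abs_integral_sub_le_exp (by positivity) hL0 ht.1
      (intervalIntegrable_rcoord hp h₁.cont h₁.nonneg h₁.le _ _ _)
      (intervalIntegrable_rcoord hp h₂.cont h₂.nonneg h₂.le _ _ _) fun s hs => ?_
    have hs' : s ∈ Set.Icc 0 τ := ⟨hs.1, hs.2.trans ht.2⟩
    have e₁ : rcoord (fun j => ζ₁ j s) 0 = ζ₁ 0 s / totalRate ζ₁ s := by
      have : 0 < rtot fun j => ζ₁ j s := hc.trans_le (hr₁ s hs')
      simp [rcoord, this, totalRate, h₁.nonneg 0 s]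
    have e₂ : rcoord (fun j => ζ₂ j s) 0 = ζ₂ 0 s / totalRate ζ₂ s := by
      have : 0 < rtot fun j => ζ₂ j s := hc.trans_le (hr₂ s hs')
      simp [rcoord, this, totalRate, h₂.nonneg 0 s]
    rw [e₁, e₂]
    have hle : ζ₂ 0 s ≤ totalRate ζ₂ s := by
      have := le_rtot (fun j => h₂.nonneg j s) (summable_mul_path hp h₂.nonneg h₂.le s) 0
      simpa [h₂.nonneg 0 s, totalRate] using this
    refine (abs_div_sub_div_le hc (hr₁ s hs') (hr₂ s hs') (h₂.nonneg 0 s) hle).trans ?_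
    calc _ ≤ (2 * (M * Real.exp (L * s)) + (2 + K) * (M * Real.exp (L * s))) / c := by
          gcongr
          · exact hΓ s hs'
          · exact hr s hs'
      _ = _ := by ring
  intro t ht
  have hE : 0 < Real.exp (L * t) := Real.exp_pos _
  have hcl := hclock t ht
  have hA : (2 + K) / c ^ 2 * M / L * Real.exp (L * t)
      + K * ((2 + K) / c ^ 2 * M / L * Real.exp (L * t))
      + 2 * ((4 + K) / c * M / L * Real.exp (L * t)) = M / 2 * Real.exp (L * t) := by
    have : (2 + K) / c ^ 2 + K * ((2 + K) / c ^ 2) + 2 * ((4 + K) / c) = L / 2 := by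
      rw [hL]; ring
    calc _ = ((2 + K) / c ^ 2 + K * ((2 + K) / c ^ 2) + 2 * ((4 + K) / c)) / L
          * (M * Real.exp (L * t)) := by ring
      _ = _ := by rw [this]; field_simp
  have hp1 : 0 ≤ (2 + K) / c ^ 2 * M / L * Real.exp (L * t) := by positivity
  have hp2 : 0 ≤ K * ((2 + K) / c ^ 2 * M / L * Real.exp (L * t)) := by positivity
  have hp3 : 0 ≤ (4 + K) / c * M / L * Real.exp (L * t) := by positivity
  refine ⟨by linarith, ?_⟩
  have hKc := mul_le_mul_of_nonneg_left hcl hK0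
  have hw := (hW t ht).trans hKc
  have hi := hInt t ht
  rw [h₁.psi_eq t (hT t ht), h₂.psi_eq t (hT t ht)]
  rw [abs_le] at hw hi ⊢
  constructor <;> linarith [hw.1, hw.2, hi.1, hi.2]

/-- Two solutions agree as long as both total rates are positive. -/
lemma eqOn_of_totalRate_pos (h₁ : IsFluidLimit T p ζ₁ ψ₁) (h₂ : IsFluidLimit T p ζ₂ ψ₂)
    (hpnn : ∀ k, 0 ≤ p k) (hp : Summable fun k : ℕ => (k : ℝ) * p k)
    (hmom2 : Summable fun k : ℕ => (k : ℝ) ^ 2 * p k) {τ : ℝ} (hτ : τ ∈ Set.Icc 0 T)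
    (hr₁ : ∀ s ∈ Set.Icc 0 τ, 0 < totalRate ζ₁ s) (hr₂ : ∀ s ∈ Set.Icc 0 τ, 0 < totalRate ζ₂ s) :
    (∀ k, ζ₁ k τ = ζ₂ k τ) ∧ ψ₁ τ = ψ₂ τ := by
  have hne : (Set.Icc 0 τ).Nonempty := Set.nonempty_Icc.2 hτ.1
  obtain ⟨c, hc, hc₁, hc₂⟩ : ∃ c : ℝ, 0 < c ∧ (∀ s ∈ Set.Icc 0 τ, c ≤ totalRate ζ₁ s) ∧
      ∀ s ∈ Set.Icc 0 τ, c ≤ totalRate ζ₂ s := by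
    have hcont := (h₁.continuous_totalRate hp).min (h₂.continuous_totalRate hp)
    obtain ⟨x, hx, hmin⟩ := isCompact_Icc.exists_isMinOn hne hcont.continuousOn
    exact ⟨_, lt_min (hr₁ x hx) (hr₂ x hx), fun s hs => (hmin hs).trans (min_le_left _ _),
      fun s hs => (hmin hs).trans (min_le_right _ _)⟩
  set K := ∑' k : ℕ, (k : ℝ) ^ 2 * p k with hK
  set L := 2 * ((2 + K) / c ^ 2 + K * ((2 + K) / c ^ 2) + 2 * ((4 + K) / c)) with hL
  have hK0 : 0 ≤ K := tsum_nonneg fun k => mul_nonneg (by positivity) (hpnn k)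
  have hL0 : 0 < L := by rw [hL]; positivity
  have hclockc : ∀ ζ ψ, IsFluidLimit T p ζ ψ → Continuous (clock ζ c) := fun ζ ψ h =>
    intervalIntegral.continuous_primitive
      (fun a b => (h.continuous_inv_max hp hc).intervalIntegrable a b) 0
  obtain ⟨M, hM⟩ : ∃ M, ∀ s ∈ Set.Icc 0 τ,
      max |clock ζ₁ c s - clock ζ₂ c s| |ψ₁ s - ψ₂ s| ≤ M := by
    have hcont := ((hclockc _ _ h₁).sub (hclockc _ _ h₂)).abs.max (h₁.cont_psi.sub h₂.cont_psi).abs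
    obtain ⟨x, hx, hmax⟩ := isCompact_Icc.exists_isMaxOn hne hcont.continuousOn
    exact ⟨_, fun s hs => hmax hs⟩
  have hM0 : 0 ≤ M := (le_max_of_le_left (abs_nonneg _)).trans (hM τ ⟨hτ.1, le_rfl⟩)
  have hiter : ∀ n : ℕ, ∀ t ∈ Set.Icc 0 τ,
      |clock ζ₁ c t - clock ζ₂ c t| ≤ M * (1 / 2) ^ n * Real.exp (L * t) ∧
      |ψ₁ t - ψ₂ t| ≤ M * (1 / 2) ^ n * Real.exp (L * t) := by
    intro n
    induction n with
    | zero =>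
      intro t ht
      have h1 : M ≤ M * (1 / 2) ^ 0 * Real.exp (L * t) := by
        rw [pow_zero, mul_one]
        exact le_mul_of_one_le_right hM0 (Real.one_le_exp (mul_nonneg hL0.le ht.1))
      exact ⟨(le_max_left _ _).trans ((hM t ht).trans h1),
        (le_max_right _ _).trans ((hM t ht).trans h1)⟩
    | succ n ih =>
      have h1 := dist_le_half h₁ h₂ hpnn hp hmom2 hc hτ hc₁ hc₂ hK hL (by positivity)
        (fun s hs => (ih s hs).1) (fun s hs => (ih s hs).2)
      intro t ht
      have h2 : M * (1 / 2) ^ (n + 1) = M * (1 / 2) ^ n / 2 := by ring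
      rw [h2]
      exact h1 t ht
  have hlim : ∀ t, Tendsto (fun n : ℕ => M * (1 / 2) ^ n * Real.exp (L * t)) atTop (𝓝 0) := by
    intro t
    have := ((tendsto_pow_atTop_nhds_zero_of_lt_one (r := (1 / 2 : ℝ)) (by norm_num)
      (by norm_num)).const_mul M).mul_const (Real.exp (L * t))
    simpa using this
  have hψeq : ∀ t ∈ Set.Icc 0 τ, ψ₁ t = ψ₂ t := fun t ht =>
    eq_of_abs_sub_nonpos (ge_of_tendsto' (hlim t) fun n => (hiter n t ht).2)
  have hτm : τ ∈ Set.Icc 0 τ := ⟨hτ.1, le_rfl⟩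
  have hSeq : clock ζ₁ c τ = clock ζ₂ c τ :=
    eq_of_abs_sub_nonpos (ge_of_tendsto' (hlim τ) fun n => (hiter n τ hτm).1)
  refine ⟨fun k => ?_, hψeq τ hτm⟩
  rcases Nat.eq_zero_or_pos k with rfl | hk
  · rw [h₁.zero_eq τ hτ, h₂.zero_eq τ hτ, skorokhod, skorokhod, Set.image_congr hψeq, hψeq τ hτm]
  · rw [h₁.eq_mul_exp hp hc hτ hc₁ hk hτm, h₂.eq_mul_exp hp hc hτ hc₂ hk hτm, hSeq]

variable {ζ : ℕ → ℝ → ℝ} {ψ : ℝ → ℝ}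

lemma totalRate_nonneg (h : IsFluidLimit T p ζ ψ) (s : ℝ) : 0 ≤ totalRate ζ s := by
  rw [h.totalRate_eq]
  exact add_nonneg (h.nonneg 0 s) (tsum_nonneg fun k => mul_nonneg k.cast_nonneg (h.nonneg k s))

lemma eq_zero_of_totalRate_eq_zero (h : IsFluidLimit T p ζ ψ)
    (hp : Summable fun k : ℕ => (k : ℝ) * p k) {s : ℝ} (hs : totalRate ζ s = 0) (k : ℕ) :
    ζ k s = 0 := by
  have h1 := le_rtot (fun j => h.nonneg j s) (summable_mul_path hp h.nonneg h.le s) k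
  change _ ≤ totalRate ζ s at h1
  rw [hs] at h1
  refine le_antisymm ?_ (h.nonneg k s)
  split_ifs at h1 with hk
  · subst hk
    exact (le_max_left _ _).trans h1
  · have : (0:ℝ) < k := by exact_mod_cast Nat.pos_of_ne_zero hk
    exact nonpos_of_mul_nonpos_right h1 this

/-- Once the total rate vanishes, the solution is frozen. -/
lemma frozen (h : IsFluidLimit T p ζ ψ) (hp : Summable fun k : ℕ => (k : ℝ) * p k)
    {τ t : ℝ} (hτ : τ ∈ Set.Icc 0 T) (hr : totalRate ζ τ = 0) (ht : t ∈ Set.Icc τ T) :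
    (∀ k, ζ k t = 0) ∧ ψ t = ψ τ := by
  have hk0 : ∀ k, 1 ≤ k → ∀ s ∈ Set.Icc τ T, ζ k s = 0 := fun k hk s hs =>
    le_antisymm ((h.anti k hk hτ ⟨hτ.1.trans hs.1, hs.2⟩ hs.1).trans
      (h.eq_zero_of_totalRate_eq_zero hp hr k).le) (h.nonneg k s)
  have hinc : ∀ a ∈ Set.Icc τ T, ∀ b ∈ Set.Icc τ T,
      ψ b - ψ a = -2 * ∫ s in a..b, rcoord (fun j => ζ j s) 0 := by
    intro a ha b hb
    rw [h.psi_eq a ⟨hτ.1.trans ha.1, ha.2⟩, h.psi_eq b ⟨hτ.1.trans hb.1, hb.2⟩,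
      ← intervalIntegral.integral_interval_sub_left
        (intervalIntegrable_rcoord hp h.cont h.nonneg h.le 0 0 b)
        (intervalIntegrable_rcoord hp h.cont h.nonneg h.le 0 0 a)]
    have : (fun k : ℕ => if k = 0 then 0 else ((k : ℝ) - 2) * (p k - ζ k a))
        = fun k : ℕ => if k = 0 then 0 else ((k : ℝ) - 2) * (p k - ζ k b) := by
      ext k
      split_ifs with hk
      · rfl
      · rw [hk0 k (Nat.one_le_iff_ne_zero.2 hk) a ha, hk0 k (Nat.one_le_iff_ne_zero.2 hk) b hb]
    rw [this]
    ring
  have hanti : ∀ a ∈ Set.Icc τ T, ∀ b ∈ Set.Icc τ T, a ≤ b → ψ b ≤ ψ a := by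
    intro a ha b hb hab
    have h1 : 0 ≤ ∫ s in a..b, rcoord (fun j => ζ j s) 0 :=
      intervalIntegral.integral_nonneg hab fun s _ => rcoord_nonneg (fun j => h.nonneg j s) 0
    linarith [hinc a ha b hb]
  have hτm : τ ∈ Set.Icc τ T := ⟨le_rfl, hτ.2⟩
  have hψτ : ψ τ = min (sInf (ψ '' Set.Icc 0 τ)) 0 := by
    have h1 := h.zero_eq τ hτ
    rw [h.eq_zero_of_totalRate_eq_zero hp hr 0, skorokhod] at h1
    linarith
  have hζ0 : ∀ s ∈ Set.Icc τ T, ζ 0 s = 0 := by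
    intro s hs
    have hs0 : 0 ≤ s := hτ.1.trans hs.1
    refine le_antisymm ?_ (h.nonneg 0 s)
    rw [h.zero_eq s ⟨hs0, hs.2⟩, skorokhod, sub_nonpos]
    have hsτ := hanti τ hτm s hs hs.1
    refine le_min (le_csInf ((Set.nonempty_Icc.2 hs0).image ψ) ?_)
      (hsτ.trans (hψτ.le.trans (min_le_right _ _)))
    rintro _ ⟨u, hu, rfl⟩
    rcases le_total u τ with huτ | huτ
    · refine hsτ.trans (hψτ.le.trans ((min_le_left _ _).trans ?_))
      exact csInf_le (isCompact_Icc.image h.cont_psi).bddBelow ⟨u, ⟨hu.1, huτ⟩, rfl⟩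
    · exact hanti u ⟨huτ, hu.2.trans hs.2⟩ s hs hu.2
  refine ⟨fun k => ?_, ?_⟩
  · rcases Nat.eq_zero_or_pos k with rfl | hk
    · exact hζ0 t ht
    · exact hk0 k hk t ht
  · have h1 : ∫ s in τ..t, rcoord (fun j => ζ j s) 0 = ∫ s in τ..t, (0:ℝ) := by
      refine intervalIntegral.integral_congr fun s hs => ?_
      rw [Set.uIcc_of_le ht.1] at hs
      simp [rcoord, hζ0 s ⟨hs.1, hs.2.trans ht.2⟩]
    have h2 := hinc τ hτm t ht
    rw [h1] at h2
    simp at h2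
    linarith

lemma totalRate_zero_pos (h : IsFluidLimit T p ζ ψ) (hT : 0 ≤ T)
    (hp : Summable fun k : ℕ => (k : ℝ) * p k) (hex : ∃ k, 1 ≤ k ∧ 0 < p k) :
    0 < totalRate ζ 0 := by
  obtain ⟨k, hk, hpk⟩ := hex
  refine (h.totalRate_nonneg 0).lt_of_ne fun h0 => ?_
  have h1 := h.eq k hk 0 ⟨le_rfl, hT⟩
  rw [h.eq_zero_of_totalRate_eq_zero hp h0.symm k] at h1
  simp at h1
  linarith

/-- The limit equations have at most one solution. -/
theorem unique (h₁ : IsFluidLimit T p ζ₁ ψ₁) (h₂ : IsFluidLimit T p ζ₂ ψ₂)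
    (hpnn : ∀ k, 0 ≤ p k) (hp : Summable fun k : ℕ => (k : ℝ) * p k)
    (hmom2 : Summable fun k : ℕ => (k : ℝ) ^ 2 * p k) (hex : ∃ k, 1 ≤ k ∧ 0 < p k)
    {t : ℝ} (ht : t ∈ Set.Icc 0 T) : (∀ k, ζ₁ k t = ζ₂ k t) ∧ ψ₁ t = ψ₂ t := by
  have hT : 0 ≤ T := ht.1.trans ht.2
  set m : ℝ → ℝ := fun s => min (totalRate ζ₁ s) (totalRate ζ₂ s) with hm
  have hmc : Continuous m := (h₁.continuous_totalRate hp).min (h₂.continuous_totalRate hp)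
  have hm0 : ∀ s, 0 ≤ m s := fun s => le_min (h₁.totalRate_nonneg s) (h₂.totalRate_nonneg s)
  have hpos : ∀ τ ∈ Set.Icc 0 T, (∀ s ∈ Set.Icc 0 τ, m s ≠ 0) →
      (∀ k, ζ₁ k τ = ζ₂ k τ) ∧ ψ₁ τ = ψ₂ τ := fun τ hτ hne =>
    eqOn_of_totalRate_pos h₁ h₂ hpnn hp hmom2 hτ
      (fun s hs => (((hm0 s).lt_of_ne' (hne s hs)).trans_le (min_le_left _ _)))
      (fun s hs => (((hm0 s).lt_of_ne' (hne s hs)).trans_le (min_le_right _ _)))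
  by_cases hne : ∀ s ∈ Set.Icc 0 t, m s ≠ 0
  · exact hpos t ht hne
  push Not at hne
  obtain ⟨s₀, hs₀, hms₀⟩ := hne
  have hcpt : IsCompact (Set.Icc 0 t ∩ m ⁻¹' {0}) :=
    isCompact_Icc.inter_right (isClosed_singleton.preimage hmc)
  obtain ⟨τ, ⟨hτt, hmτ⟩, hleast⟩ := hcpt.exists_isLeast ⟨s₀, hs₀, hms₀⟩
  have hmτ : m τ = 0 := hmτ
  have hτT : τ ∈ Set.Icc 0 T := ⟨hτt.1, hτt.2.trans ht.2⟩
  have hτ0 : 0 < τ := by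
    refine hτt.1.lt_of_ne fun h0 => ?_
    rw [← h0] at hmτ
    exact (lt_min (h₁.totalRate_zero_pos hT hp hex)
      (h₂.totalRate_zero_pos hT hp hex)).ne' hmτ
  have hbefore : ∀ s ∈ Set.Ico 0 τ, (∀ k, ζ₁ k s = ζ₂ k s) ∧ ψ₁ s = ψ₂ s := fun s hs =>
    hpos s ⟨hs.1, hs.2.le.trans hτT.2⟩ fun u hu hmu =>
      (hu.2.trans_lt hs.2).not_ge (hleast ⟨⟨hu.1, hu.2.trans (hs.2.le.trans hτt.2)⟩, hmu⟩)
  have hclos : τ ∈ closure (Set.Ico 0 τ) := by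
    rw [closure_Ico hτ0.ne]; exact ⟨hτ0.le, le_rfl⟩
  have heq : ∀ f g : ℝ → ℝ, Continuous f → Continuous g → Set.EqOn f g (Set.Ico 0 τ) →
      f τ = g τ := fun f g hf hg hfg => hfg.closure hf hg hclos
  have hζτ : ∀ k, ζ₁ k τ = ζ₂ k τ := fun k =>
    heq _ _ (h₁.cont k) (h₂.cont k) fun s hs => (hbefore s hs).1 k
  have hψτ : ψ₁ τ = ψ₂ τ :=
    heq _ _ h₁.cont_psi h₂.cont_psi fun s hs => (hbefore s hs).2
  have hrr : totalRate ζ₁ τ = totalRate ζ₂ τ := by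
    simp only [totalRate, hζτ]
  have hr₁ : totalRate ζ₁ τ = 0 := by
    have : min (totalRate ζ₁ τ) (totalRate ζ₂ τ) = 0 := hmτ
    rwa [← hrr, min_self] at this
  have f₁ := h₁.frozen hp hτT hr₁ ⟨hτt.2, ht.2⟩
  have f₂ := h₂.frozen hp hτT (hrr ▸ hr₁) ⟨hτt.2, ht.2⟩
  exact ⟨fun k => (f₁.1 k).trans (f₂.1 k).symm, by rw [f₁.2, f₂.2, hψτ]⟩

end IsFluidLimit

/-- There is at most one pair `(ζ, ψ)` at which the rate function `I_T` vanishes. -/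
theorem uniqueness_of_rate_zero (T : ℝ) (hT : 0 < T)
    (p : ℕ → ℝ) (hp0 : p 0 = 0) (hpnn : ∀ k, 0 ≤ p k) (hp1 : ∑' k : ℕ, p k = 1)
    (hmom2 : Summable fun k : ℕ => (k : ℝ) ^ 2 * p k)
    (ζ₁ ζ₂ : ℕ → ℝ → ℝ) (ψ₁ ψ₂ : ℝ → ℝ)
    (h₁ : rateI T p ζ₁ ψ₁ = 0) (h₂ : rateI T p ζ₂ ψ₂ = 0) :
    (∀ k : ℕ, ∀ t ∈ Set.Icc (0 : ℝ) T, ζ₁ k t = ζ₂ k t) ∧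
    (∀ t ∈ Set.Icc (0 : ℝ) T, ψ₁ t = ψ₂ t) := by
  have hp : Summable fun k : ℕ => (k : ℝ) * p k := by
    refine hmom2.of_nonneg_of_le (fun k => mul_nonneg k.cast_nonneg (hpnn k)) fun k => ?_
    refine mul_le_mul_of_nonneg_right ?_ (hpnn k)
    exact_mod_cast Nat.le_self_pow two_ne_zero k
  have hex : ∃ k, 1 ≤ k ∧ 0 < p k := by
    by_contra! hcon
    have : p = 0 := by
      ext k
      rcases Nat.eq_zero_or_pos k with rfl | hk
      · exact hp0
      · exact le_antisymm (hcon k hk) (hpnn k)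
    simp [this] at hp1
  have key := fun t (ht : t ∈ Set.Icc 0 T) =>
    (isFluidLimit_of_rateI_eq_zero hT hp h₁).unique (isFluidLimit_of_rateI_eq_zero hT hp h₂)
      hpnn hp hmom2 hex ht
  refine ⟨fun k t ht => ?_, fun t ht => ?_⟩
  · simpa only [Set.IccExtend_of_mem hT.le _ ht, Set.domRestrict_apply] using (key t ht).1 k
  · simpa only [Set.IccExtend_of_mem hT.le _ ht, Set.domRestrict_apply] using (key t ht).2
end

section
/- Let p = (p_k)_{k≥1} be a probability distribution on the positive integers with μ := ∑_{k≥1} k·p_k ∈ (0,∞), and let ρ ∈ [0,1) satisfy ∑_{k≥1} k·p_k·ρ^{k−1} = μ·ρ (i.e. G_1(ρ) = ρ where G_1(z) := ∑_{k≥1} (k·p_k/μ)·z^{k−1}). Then ∑_{k≥1} k(k−2)·p_k·ρ^k ≤ 0. -/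
/-- A form of Bernoulli's inequality: the tangent line at `ρ` bounds a power from below at `1`. -/
theorem one_sub_mul_mul_pow_le {ρ : ℝ} (h0 : 0 ≤ ρ) (n : ℕ) :
    (1 - ρ) * ((n : ℝ) - 1) * ρ ^ (n + 1) ≤ ρ ^ 2 - ρ * ρ ^ n := by
  induction n with
  | zero => simp; nlinarith
  | succ n ih =>
    have h : 0 ≤ ρ ^ (n + 1) * (1 - ρ) ^ 2 * n := by positivity
    push_cast
    ring_nf at h ih ⊢
    linarith

/-- If `ρ ∈ [0,1)` is a fixed point of `G₁`, i.e. `∑ k p_k ρ^(k-1) = μ ρ`, then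
`∑ k (k-2) p_k ρ^k ≤ 0`. The distribution `p` is indexed by `ℕ` with `p 0 = 0`. -/
theorem fixed_point_subcritical (p : ℕ → ℝ) (hp0 : p 0 = 0) (hpnn : ∀ k, 0 ≤ p k)
    (hp1 : ∑' k : ℕ, p k = 1)
    (hμsum : Summable fun k : ℕ => (k : ℝ) * p k)
    (mu : ℝ) (hmu : mu = ∑' k : ℕ, (k : ℝ) * p k) (hmupos : 0 < mu)
    (ρ : ℝ) (hρ : ρ ∈ Set.Ico (0 : ℝ) 1)
    (hfix : ∑' k : ℕ, (k : ℝ) * p k * ρ ^ (k - 1) = mu * ρ) :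
    ∑' k : ℕ, (k : ℝ) * ((k : ℝ) - 2) * p k * ρ ^ k ≤ 0 := by
  obtain ⟨h0, h1⟩ := hρ
  by_cases hs : Summable fun k : ℕ => (k : ℝ) * ((k : ℝ) - 2) * p k * ρ ^ k
  swap
  · exact (tsum_eq_zero_of_not_summable hs).le
  have hnn : ∀ k : ℕ, 0 ≤ (k : ℝ) * p k := fun k => mul_nonneg k.cast_nonneg (hpnn k)
  have hG : Summable fun k : ℕ => (k : ℝ) * p k * ρ ^ (k - 1) :=
    hμsum.of_nonneg_of_le (fun k => mul_nonneg (hnn k) (pow_nonneg h0 _))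
      fun k => mul_le_of_le_one_right (hnn k) (pow_le_one₀ h0 h1.le)
  have hterm : ∀ k : ℕ, (1 - ρ) * ((k : ℝ) * ((k : ℝ) - 2) * p k * ρ ^ k) ≤
      ρ ^ 2 * ((k : ℝ) * p k) - ρ * ((k : ℝ) * p k * ρ ^ (k - 1)) := by
    rintro (_ | n)
    · simp
    · have h := mul_le_mul_of_nonneg_left (one_sub_mul_mul_pow_le h0 n) (hnn (n + 1))
      rw [Nat.add_sub_cancel]
      push_cast at h ⊢
      linarith
  have hle := (hs.mul_left (1 - ρ)).tsum_le_tsum hterm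
    ((hμsum.mul_left (ρ ^ 2)).sub (hG.mul_left ρ))
  rw [(hμsum.mul_left (ρ ^ 2)).tsum_sub (hG.mul_left ρ), tsum_mul_left, tsum_mul_left,
    tsum_mul_left, hfix, ← hmu] at hle
  have hz : ρ ^ 2 * mu - ρ * (mu * ρ) = 0 := by ring
  rw [hz] at hle
  exact nonpos_of_mul_nonpos_right hle (sub_pos.mpr h1)
end
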